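/- Let G be a finite group, N ⊴ G, θ ∈ Irr(N) G-invariant, and suppose the order of [θ]_{G/N} ∈ H²(G/N,ℂ^×) is a π-number, for a set of primes π. Then the number of π-defect zero irreducible characters of G/N equals the number of irreducible characters χ of G lying over θ with (χ(1)/θ(1))_π = |G/N|_π. -/

import Mathlib

open scoped BigOperators
noncomputable section

open Classical in
/-- The `π`-part of a natural number: the product of prime powers in its
factorization whose primes lie in `π`. -/
def Nat.piPart (π : Set ℕ) (n : ℕ) : ℕ :=
  n.factorization.prod fun p k => if p ∈ π then p ^ k else 1

/-- `n` is a `π`-number if every prime dividing `n` lies in `π`. -/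
def IsPiNumber (π : Set ℕ) (n : ℕ) : Prop :=
  ∀ p : ℕ, p.Prime → p ∣ n → p ∈ π

/-- The `π`-part of an element of a finite group: the unique power of `g`
whose order is a `π`-number and whose complementary part has `π'`-order. -/
def elemPiPart (π : Set ℕ) {G : Type} [Group G] (g : G) : G :=
  g ^ ((orderOf g / Nat.piPart π (orderOf g)) ^ Nat.totient (Nat.piPart π (orderOf g)))

/-- `χ` is the character of some finite-dimensional complex representation of `G`. -/
def IsChar (G : Type) [Group G] (χ : G → ℂ) : Prop :=
  ∃ V : FDRep ℂ G, ∀ g : G, χ g = V.character g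

/-- The usual inner product of complex class functions. -/
def charInner (G : Type) [Group G] (φ ψ : G → ℂ) : ℂ :=
  (Nat.card G : ℂ)⁻¹ * ∑ᶠ g : G, φ g * starRingEnd ℂ (ψ g)

/-- An irreducible character: a character of norm one. -/
def IsIrrChar (G : Type) [Group G] (χ : G → ℂ) : Prop :=
  IsChar G χ ∧ charInner G χ χ = 1

/-- A class function. -/
def IsClassFun (G : Type) [Group G] (φ : G → ℂ) : Prop :=
  ∀ g h : G, φ (h * g * h⁻¹) = φ g

/-- A virtual (generalized) character: a difference of two characters. -/
def IsGenChar (G : Type) [Group G] (ψ : G → ℂ) : Prop :=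
  ∃ α β : G → ℂ, IsChar G α ∧ IsChar G β ∧ ψ = α - β

/-- `θ`, a character of the normal subgroup `N` of `G`, is `G`-invariant. -/
def IsGInvariant {G : Type} [Group G] (N : Subgroup G) [hN : N.Normal]
    (θ : ↥N → ℂ) : Prop :=
  ∀ (g : G) (n : ↥N), θ ⟨g * (n : G) * g⁻¹, hN.conj_mem (n : G) n.2 g⟩ = θ n

/-- π-defect zero irreducible characters of a group `Q`. -/
def dzSet (π : Set ℕ) (Q : Type) [Group Q] : Set (Q → ℂ) :=
  {χ | IsIrrChar Q χ ∧ ∃ d : ℕ, χ 1 = (d : ℂ) ∧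
    Nat.piPart π d = Nat.piPart π (Nat.card Q)}

/-- Irreducible characters of `G` lying over `θ ∈ Irr N` of relative π-defect zero. -/
def rdzSet (π : Set ℕ) (G : Type) [Group G] (N : Subgroup G) (θ : ↥N → ℂ) :
    Set (G → ℂ) :=
  {χ | IsIrrChar G χ ∧ charInner ↥N (fun n : ↥N => χ (n : G)) θ ≠ 0 ∧
    ∃ m : ℕ, χ 1 = θ 1 * (m : ℂ) ∧ Nat.piPart π m = Nat.piPart π N.index}


def IsTwoCocycle {Q : Type} [Group Q] (a : Q → Q → ℂˣ) : Prop :=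
  ∀ x y z : Q, a x y * a (x * y) z = a y z * a x (y * z)

def IsTwoCoboundary {Q : Type} [Group Q] (a : Q → Q → ℂˣ) : Prop :=
  ∃ ν : Q → ℂˣ, ∀ x y : Q, a x y = ν x * ν y * (ν (x * y))⁻¹

/-- The order of the cohomology class of a 2-cocycle `a` in `H²(Q, ℂˣ)`:
the least positive `m` such that `a^m` is a coboundary. -/
def cocycleClassOrder {Q : Type} [Group Q] (a : Q → Q → ℂˣ) : ℕ :=
  sInf {m | 0 < m ∧ IsTwoCoboundary fun x y => a x y ^ m}

/-- The data of a projective representation of `G` associated with the character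
triple `(G, N, θ)`, with factor set inflated from a 2-cocycle on `G ⧸ N`
(Isaacs, Theorem 11.2): its cohomology class is `[θ]_{G/N}`. -/
structure ProjRepOfTriple (G : Type) [Group G] (N : Subgroup G) [N.Normal]
    (θ : ↥N → ℂ) where
  d : ℕ
  X : G → Matrix (Fin d) (Fin d) ℂ
  a : G ⧸ N → G ⧸ N → ℂˣ
  cocycle : IsTwoCocycle a
  factor : ∀ g h : G, X g * X h = (a (g : G ⧸ N) (h : G ⧸ N) : ℂ) • X (g * h)
  map_one : X 1 = 1
  unit : ∀ g : G, IsUnit (X g)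
  traceN : ∀ n : ↥N, Matrix.trace (X (n : G)) = θ n
  mulN_left : ∀ (n : ↥N) (g : G), X ((n : G) * g) = X (n : G) * X g
  mulN_right : ∀ (n : ↥N) (g : G), X (g * (n : G)) = X g * X (n : G)

open scoped ComplexConjugate

theorem IsChar.of_rep {G V : Type} [Group G] [AddCommGroup V] [Module ℂ V]
    [FiniteDimensional ℂ V] (ρ : Representation ℂ G V) : IsChar G ρ.character :=
  ⟨FDRep.of ρ, fun _ => rfl⟩

theorem IsChar.exists_rep {G : Type} [Group G] {χ : G → ℂ} (h : IsChar G χ) :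
    ∃ (V : Type) (_ : AddCommGroup V) (_ : Module ℂ V) (_ : FiniteDimensional ℂ V)
      (ρ : Representation ℂ G V), χ = ρ.character := by
  obtain ⟨V, hV⟩ := h
  exact ⟨V, inferInstance, inferInstance, inferInstance, V.ρ, funext hV⟩

open scoped ComplexOrder in
theorem Matrix.trace_inv_eq_star_trace {G n : Type} [Group G] [Finite G] [Fintype n]
    [DecidableEq n] (A : G →* Matrix n n ℂ) (g : G) :
    (A g⁻¹).trace = conj (A g).trace := by
  cases nonempty_fintype G
  set H : Matrix n n ℂ := ∑ h, (A h).conjTranspose * A h with hH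
  have hpos : H.PosDef := by
    refine Matrix.posDef_sum Finset.univ_nonempty fun h _ => ?_
    refine Matrix.PosDef.conjTranspose_mul_self _ ?_
    refine Matrix.mulVec_injective_of_isUnit ?_
    exact (Group.isUnit h).map A
  have hU : IsUnit H := hpos.isUnit
  have hinv : (A g).conjTranspose * H = H * A g⁻¹ := by
    rw [hH, Finset.mul_sum, Finset.sum_mul]
    refine Fintype.sum_equiv (Equiv.mulRight g) _ _ fun h => ?_
    simp only [Equiv.coe_mulRight, map_mul, Matrix.conjTranspose_mul, mul_assoc]
    rw [← map_mul A g g⁻¹, mul_inv_cancel, map_one, mul_one]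
  obtain ⟨u, hu⟩ := hU
  have : A g⁻¹ = (↑u⁻¹ : Matrix n n ℂ) * ((A g).conjTranspose * H) := by
    rw [hinv, ← mul_assoc, ← hu, Units.inv_mul, one_mul]
  rw [this, Matrix.trace_mul_comm, mul_assoc, ← hu, Units.mul_inv, mul_one,
    Matrix.trace_conjTranspose]
  rfl

section basic

variable {G H : Type} [Group G] [Group H]

theorem IsChar.exists_matrix {χ : G → ℂ} (h : IsChar G χ) :
    ∃ (d : ℕ) (A : G →* Matrix (Fin d) (Fin d) ℂ), ∀ g, χ g = (A g).trace := by
  obtain ⟨V, _, _, _, ρ, rfl⟩ := h.exists_rep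
  let b := Module.finBasis ℂ V
  refine ⟨_, (MonoidHomClass.toMonoidHom (LinearMap.toMatrixAlgEquiv b)).comp ρ, fun g => ?_⟩
  exact LinearMap.trace_eq_matrix_trace ℂ b _

theorem IsChar.of_matrix {n : Type} [Fintype n] [DecidableEq n] {χ : G → ℂ}
    (A : G →* Matrix n n ℂ) (hA : ∀ g, χ g = (A g).trace) : IsChar G χ := by
  let ρ : Representation ℂ G (n → ℂ) := (MonoidHomClass.toMonoidHom Matrix.toLinAlgEquiv').comp A
  have : χ = ρ.character := by
    funext g
    rw [hA]
    exact (Matrix.trace_toLin'_eq (A g)).symm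
  rw [this]
  exact .of_rep ρ

theorem IsChar.inv_apply [Finite G] {χ : G → ℂ} (h : IsChar G χ) (g : G) :
    χ g⁻¹ = conj (χ g) := by
  obtain ⟨d, A, hA⟩ := h.exists_matrix
  rw [hA, hA, Matrix.trace_inv_eq_star_trace]

theorem IsChar.mul {α β : G → ℂ} (hα : IsChar G α) (hβ : IsChar G β) : IsChar G (α * β) := by
  obtain ⟨V, _, _, _, ρ, rfl⟩ := hα.exists_rep
  obtain ⟨W, _, _, _, σ, rfl⟩ := hβ.exists_rep
  rw [← Representation.char_tensor]
  exact .of_rep _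

theorem IsChar.conj [Finite G] {α : G → ℂ} (hα : IsChar G α) :
    IsChar G (fun g => conj (α g)) := by
  have : (fun g => conj (α g)) = fun g => α g⁻¹ := funext fun g => (hα.inv_apply g).symm
  rw [this]
  obtain ⟨V, _, _, _, ρ, rfl⟩ := hα.exists_rep
  have h2 : (fun g => ρ.character g⁻¹) = ρ.dual.character :=
    funext fun g => (Representation.char_dual _ g).symm
  rw [h2]
  exact .of_rep _

theorem IsChar.comp {α : G → ℂ} (hα : IsChar G α) (f : H →* G) : IsChar H (fun h => α (f h)) := by
  obtain ⟨V, _, _, _, ρ, rfl⟩ := hα.exists_rep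
  exact .of_rep (ρ.comp f)

theorem IsChar.one : IsChar G 1 := by
  have : (1 : G → ℂ) = (Representation.trivial ℂ G ℂ).character := by
    funext g
    simp [Representation.character]
  rw [this]
  exact .of_rep _

theorem IsChar.conj_apply {α : G → ℂ} (hα : IsChar G α) (g h : G) : α (h * g * h⁻¹) = α g := by
  obtain ⟨V, _, _, _, ρ, rfl⟩ := hα.exists_rep
  exact Representation.char_conj _ _ _

theorem IsChar.exists_degree {α : G → ℂ} (hα : IsChar G α) : ∃ d : ℕ, α 1 = d := by
  obtain ⟨V, _, _, _, ρ, rfl⟩ := hα.exists_rep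
  exact ⟨_, Representation.char_one _⟩

theorem IsChar.eq_zero {α : G → ℂ} (hα : IsChar G α) (h : α 1 = 0) : α = 0 := by
  obtain ⟨d, A, hA⟩ := hα.exists_matrix
  have : d = 0 := by simpa [hA] using h
  subst this
  funext g
  simp [hA, Matrix.trace]

theorem charInner_eq_sum [Fintype G] (φ ψ : G → ℂ) :
    charInner G φ ψ = (Nat.card G : ℂ)⁻¹ * ∑ g, φ g * conj (ψ g) := by
  rw [charInner, finsum_eq_sum_of_fintype]

theorem charInner_rep [Finite G] {V W : Type} [AddCommGroup V] [Module ℂ V]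
    [FiniteDimensional ℂ V] [AddCommGroup W] [Module ℂ W] [FiniteDimensional ℂ W]
    (ρ : Representation ℂ G V) (σ : Representation ℂ G W) :
    charInner G σ.character ρ.character = Module.finrank ℂ (ρ.IntertwiningMap σ) := by
  cases nonempty_fintype G
  have : Invertible (Nat.card G : ℂ) := invertibleOfNonzero (by simp)
  rw [← Representation.card_inv_mul_sum_char_mul_char_eq_finrank, charInner_eq_sum]
  congr 1
  refine Finset.sum_congr rfl fun g _ => ?_
  rw [(IsChar.of_rep ρ).inv_apply]

theorem IsChar.charInner_nat [Finite G] {α β : G → ℂ} (hα : IsChar G α) (hβ : IsChar G β) :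
    ∃ n : ℕ, charInner G α β = n := by
  obtain ⟨V, _, _, _, ρ, rfl⟩ := hα.exists_rep
  obtain ⟨W, _, _, _, σ, rfl⟩ := hβ.exists_rep
  exact ⟨_, charInner_rep _ _⟩

theorem charInner_add_left [Finite G] (φ₁ φ₂ ψ : G → ℂ) :
    charInner G (φ₁ + φ₂) ψ = charInner G φ₁ ψ + charInner G φ₂ ψ := by
  cases nonempty_fintype G
  simp only [charInner_eq_sum, ← mul_add, ← Finset.sum_add_distrib, Pi.add_apply, add_mul]

theorem charInner_smul_left [Finite G] (c : ℂ) (φ ψ : G → ℂ) :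
    charInner G (c • φ) ψ = c * charInner G φ ψ := by
  cases nonempty_fintype G
  simp only [charInner_eq_sum, Pi.smul_apply, smul_eq_mul, mul_assoc, ← Finset.mul_sum]
  ring

theorem charInner_conj_symm [Finite G] (φ ψ : G → ℂ) :
    conj (charInner G φ ψ) = charInner G ψ φ := by
  cases nonempty_fintype G
  simp only [charInner_eq_sum, map_mul, map_inv₀, map_sum, Complex.conj_conj, map_natCast]
  congr 1
  exact Finset.sum_congr rfl fun _ _ => mul_comm _ _

theorem charInner_neg_left [Finite G] (φ ψ : G → ℂ) :
    charInner G (-φ) ψ = - charInner G φ ψ := by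
  have := charInner_smul_left (-1) φ ψ
  simpa using this

theorem charInner_sub_left [Finite G] (φ₁ φ₂ ψ : G → ℂ) :
    charInner G (φ₁ - φ₂) ψ = charInner G φ₁ ψ - charInner G φ₂ ψ := by
  rw [sub_eq_add_neg, charInner_add_left, charInner_neg_left, sub_eq_add_neg]

theorem charInner_sub_right [Finite G] (φ ψ₁ ψ₂ : G → ℂ) :
    charInner G φ (ψ₁ - ψ₂) = charInner G φ ψ₁ - charInner G φ ψ₂ := by
  rw [← charInner_conj_symm, charInner_sub_left, map_sub, charInner_conj_symm,
    charInner_conj_symm]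

theorem charInner_add_right [Finite G] (φ ψ₁ ψ₂ : G → ℂ) :
    charInner G φ (ψ₁ + ψ₂) = charInner G φ ψ₁ + charInner G φ ψ₂ := by
  rw [← charInner_conj_symm, charInner_add_left, map_add, charInner_conj_symm,
    charInner_conj_symm]

theorem charInner_smul_right [Finite G] (c : ℂ) (φ ψ : G → ℂ) :
    charInner G φ (c • ψ) = conj c * charInner G φ ψ := by
  rw [← charInner_conj_symm, charInner_smul_left, map_mul, charInner_conj_symm]

theorem charInner_self [Fintype G] (φ : G → ℂ) :
    charInner G φ φ = (((Nat.card G : ℝ)⁻¹ * ∑ g, ‖φ g‖ ^ 2 : ℝ) : ℂ) := by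
  simp only [charInner_eq_sum, Complex.mul_conj']
  push_cast
  rfl

theorem eq_zero_of_charInner_self_nonpos [Finite G] {φ : G → ℂ} {r : ℝ}
    (h : charInner G φ φ = r) (hr : r ≤ 0) : φ = 0 := by
  cases nonempty_fintype G
  rw [charInner_self, Complex.ofReal_inj] at h
  have hc : (0 : ℝ) < (Nat.card G : ℝ)⁻¹ := by
    have := Nat.card_pos (α := G)
    positivity
  have hs : ∑ g, ‖φ g‖ ^ 2 ≤ 0 := by
    by_contra! hlt
    have := mul_pos hc hlt
    linarith
  have hs0 : ∑ g, ‖φ g‖ ^ 2 = 0 := le_antisymm hs (by positivity)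
  rw [Finset.sum_eq_zero_iff_of_nonneg (fun _ _ => by positivity)] at hs0
  funext g
  simpa using hs0 g (Finset.mem_univ g)

end basic

section compress

variable {G Q V : Type} [Group G] [Group Q] [AddCommGroup V] [Module ℂ V]
  [FiniteDimensional ℂ V]

theorem IsChar.of_idempotent {f : G →* Q} (hf : Function.Surjective f)
    (ρ : Representation ℂ G V) (e : V →ₗ[ℂ] V) (he : e ∘ₗ e = e)
    (hc : ∀ g, e ∘ₗ ρ g = ρ g ∘ₗ e) (hk : ∀ g ∈ f.ker, e ∘ₗ ρ g = e)
    {χ : Q → ℂ} (hχ : ∀ g, χ (f g) = LinearMap.trace ℂ V (ρ g ∘ₗ e)) : IsChar Q χ := by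
  let W := LinearMap.range e
  let p : V →ₗ[ℂ] W := e.rangeRestrict
  let ι : W →ₗ[ℂ] V := W.subtype
  have hιp : ι ∘ₗ p = e := LinearMap.ext fun _ => rfl
  have hι : Function.Injective ι := Subtype.val_injective
  have hpι : p ∘ₗ ι = LinearMap.id := by
    refine LinearMap.ext fun w => hι ?_
    obtain ⟨w, v, rfl⟩ := w
    exact LinearMap.congr_fun he v
  have hpe : p ∘ₗ e = p := by rw [← hιp, ← LinearMap.comp_assoc, hpι, LinearMap.id_comp]
  have heι : e ∘ₗ ι = ι := by rw [← hιp, LinearMap.comp_assoc, hpι, LinearMap.comp_id]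
  have hpk : ∀ g ∈ f.ker, p ∘ₗ ρ g = p := fun g hg => by
    rw [← hpe, LinearMap.comp_assoc, hk g hg]
  let r : G → (W →ₗ[ℂ] W) := fun g => p ∘ₗ ρ g ∘ₗ ι
  have hr : ∀ g h, f g = f h → r g = r h := fun g h hgh => by
    have hmem : g * h⁻¹ ∈ f.ker := by simp [MonoidHom.mem_ker, hgh]
    have h1 : ρ g = ρ (g * h⁻¹) ∘ₗ ρ h := by
      rw [← Module.End.mul_eq_comp, ← map_mul, inv_mul_cancel_right]
    change p ∘ₗ ρ g ∘ₗ ι = p ∘ₗ ρ h ∘ₗ ι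
    rw [h1, LinearMap.comp_assoc, ← LinearMap.comp_assoc _ _ p, hpk _ hmem]
  let s : Q → G := Function.surjInv hf
  have hs : ∀ x, f (s x) = x := Function.surjInv_eq hf
  let σ : Representation ℂ Q W :=
    { toFun := fun x => r (s x)
      map_one' := by
        rw [hr (s 1) 1 (by simp [hs])]
        change p ∘ₗ ρ 1 ∘ₗ ι = LinearMap.id
        rw [map_one, Module.End.one_eq_id, LinearMap.id_comp, hpι]
      map_mul' := fun x y => by
        rw [hr (s (x * y)) (s x * s y) (by simp [hs])]
        change p ∘ₗ ρ _ ∘ₗ ι = (p ∘ₗ ρ _ ∘ₗ ι) ∘ₗ p ∘ₗ ρ _ ∘ₗ ι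
        have : (p ∘ₗ ρ (s x) ∘ₗ ι) ∘ₗ p ∘ₗ ρ (s y) ∘ₗ ι
            = p ∘ₗ ρ (s x) ∘ₗ (ι ∘ₗ p) ∘ₗ ρ (s y) ∘ₗ ι := rfl
        rw [this, hιp, ← LinearMap.comp_assoc _ _ e, hc, LinearMap.comp_assoc, heι, map_mul]
        rfl }
  have : χ = σ.character := by
    funext x
    obtain ⟨g, rfl⟩ := hf x
    rw [hχ]
    change _ = LinearMap.trace ℂ W (r (s (f g)))
    rw [hr (s (f g)) g (by simp [hs])]
    change _ = LinearMap.trace ℂ W (p ∘ₗ (ρ g ∘ₗ ι))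
    rw [← hιp]
    exact LinearMap.trace_comp_comm' p (ρ g ∘ₗ ι)
  rw [this]
  exact .of_rep _

end compress

variable {G Q : Type} [Group G] [Group Q]

/-- Averaging a character over the kernel of a surjection gives a character of the image. -/
theorem IsChar.average [Fintype G] {f : G →* Q} [Fintype f.ker] (hf : Function.Surjective f) {α : G → ℂ}
    (hα : IsChar G α) {χ : Q → ℂ}
    (hχ : ∀ g, χ (f g) = (Nat.card f.ker : ℂ)⁻¹ * ∑ k : f.ker, α (g * k)) : IsChar Q χ := by
  obtain ⟨V, _, _, _, ρ, rfl⟩ := hα.exists_rep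
  set S : V →ₗ[ℂ] V := ∑ k : f.ker, ρ k with hS
  set c : ℂ := (Nat.card f.ker : ℂ)⁻¹ with hc
  have hc1 : c * (Fintype.card f.ker : ℂ) = 1 := by
    rw [hc, Nat.card_eq_fintype_card, inv_mul_cancel₀]
    exact_mod_cast Fintype.card_ne_zero
  have hSk : ∀ g ∈ f.ker, S ∘ₗ ρ g = S := fun g hg => by
    rw [hS, ← Module.End.mul_eq_comp, Finset.sum_mul]
    refine Fintype.sum_equiv (Equiv.mulRight (⟨g, hg⟩ : f.ker)) _ _ fun k => ?_
    simp
  have hSS : S ∘ₗ S = (Fintype.card f.ker : ℂ) • S := by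
    conv_lhs => rw [← Module.End.mul_eq_comp]; arg 2; rw [hS]
    rw [Finset.mul_sum, Finset.sum_congr rfl
      (fun (k : f.ker) _ => show S * ρ k = S from hSk k k.2)]
    simp [Nat.cast_smul_eq_nsmul]
  refine .of_idempotent hf ρ (c • S) ?_ ?_ ?_ ?_
  · rw [LinearMap.smul_comp, LinearMap.comp_smul, hSS, smul_smul, smul_smul, mul_assoc, hc1,
      mul_one]
  · intro g
    rw [LinearMap.smul_comp, LinearMap.comp_smul]
    congr 1
    rw [hS, ← Module.End.mul_eq_comp, ← Module.End.mul_eq_comp, Finset.sum_mul, Finset.mul_sum]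
    have hn : f.ker.Normal := inferInstance
    refine Fintype.sum_equiv ((MulAut.conjNormal g⁻¹ : MulAut f.ker).toEquiv) _ _ fun k => ?_
    simp [← map_mul, mul_assoc]
  · intro g hg
    rw [LinearMap.smul_comp, hSk g hg]
  · intro g
    rw [hχ, LinearMap.comp_smul, map_smul, smul_eq_mul, hS, ← Module.End.mul_eq_comp,
      Finset.mul_sum (s := Finset.univ) (f := fun k : f.ker => ρ k) (a := ρ g), map_sum]
    simp [Representation.character]

theorem IsChar.descend [Finite G] {f : G →* Q} (hf : Function.Surjective f) {χ : Q → ℂ}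
    (h : IsChar G (fun g => χ (f g))) : IsChar Q χ := by
  cases nonempty_fintype G
  have := Fintype.ofFinite f.ker
  refine h.average hf fun g => ?_
  have : ∀ k : f.ker, f k = 1 := fun k => k.2
  simp only [map_mul, this, mul_one, Finset.sum_const, Finset.card_univ, nsmul_eq_mul,
    Nat.card_eq_fintype_card]
  rw [inv_mul_cancel_left₀]
  exact_mod_cast Fintype.card_ne_zero

theorem LinearMap.exists_generalized_inverse {V : Type} [AddCommGroup V] [Module ℂ V]
    (φ : V →ₗ[ℂ] V) : ∃ ψ : V →ₗ[ℂ] V, φ ∘ₗ ψ ∘ₗ φ = φ := by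
  obtain ⟨r, hr⟩ := φ.rangeRestrict.exists_rightInverse_of_surjective φ.range_rangeRestrict
  obtain ⟨l, hl⟩ := (LinearMap.range φ).subtype.exists_leftInverse_of_injective
    (Submodule.ker_subtype _)
  refine ⟨r ∘ₗ l, LinearMap.ext fun v => ?_⟩
  have h1 := LinearMap.congr_fun hl (φ.rangeRestrict v)
  have h2 := LinearMap.congr_fun hr (φ.rangeRestrict v)
  have h3 := congrArg Subtype.val h2
  simp only [LinearMap.comp_apply, LinearMap.id_apply, Submodule.subtype_apply] at h1 h3 ⊢
  change φ (r (l (φ v))) = φ v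
  change l (φ v) = _ at h1
  rw [h1]
  exact h3

section schur

variable {V : Type} [AddCommGroup V] [Module ℂ V] [FiniteDimensional ℂ V]

theorem Representation.exists_eq_smul_of_commute [Finite G] {ρ : Representation ℂ G V}
    (hρ : charInner G ρ.character ρ.character = 1) {T : V →ₗ[ℂ] V}
    (hT : ∀ g, T ∘ₗ ρ g = ρ g ∘ₗ T) : ∃ c : ℂ, T = c • LinearMap.id := by
  rw [charInner_rep] at hρ
  have h1 : Module.finrank ℂ (ρ.IntertwiningMap ρ) = 1 := by exact_mod_cast hρ
  let I : ρ.IntertwiningMap ρ := ⟨LinearMap.id, fun g => rfl⟩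
  let T' : ρ.IntertwiningMap ρ := ⟨T, hT⟩
  have hI : I ≠ 0 := by
    intro h0
    have hid : (LinearMap.id : V →ₗ[ℂ] V) = 0 :=
      congrArg Representation.IntertwiningMap.toLinearMap h0
    have : Subsingleton (ρ.IntertwiningMap ρ) := by
      refine ⟨fun a b => Representation.IntertwiningMap.ext ?_⟩
      refine LinearMap.ext fun v => ?_
      have hv : v = 0 := LinearMap.congr_fun hid v
      rw [hv, map_zero, map_zero]
    rw [Module.finrank_zero_of_subsingleton] at h1
    exact zero_ne_one h1
  obtain ⟨c, hc⟩ := (finrank_eq_one_iff_of_nonzero' I hI).1 h1 T'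
  exact ⟨c, (congrArg Representation.IntertwiningMap.toLinearMap hc).symm⟩

theorem Representation.exists_idempotent [Finite G] {ρ : Representation ℂ G V} {T : V →ₗ[ℂ] V}
    (hT : ∀ g, T ∘ₗ ρ g = ρ g ∘ₗ T) (hT' : ∀ c : ℂ, T ≠ c • LinearMap.id) :
    ∃ e : V →ₗ[ℂ] V, e ∘ₗ e = e ∧ (∀ g, e ∘ₗ ρ g = ρ g ∘ₗ e) ∧ e ≠ 0 ∧ e ≠ LinearMap.id := by
  cases nonempty_fintype G
  have : Nontrivial V := by
    by_contra h
    rw [not_nontrivial_iff_subsingleton] at h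
    exact hT' 0 (LinearMap.ext fun v => Subsingleton.elim _ _)
  obtain ⟨c, hc⟩ := Module.End.exists_eigenvalue T
  set φ : V →ₗ[ℂ] V := T - c • LinearMap.id with hφ
  have hφ0 : φ ≠ 0 := sub_ne_zero.2 (hT' c)
  have hφc : ∀ g, φ * ρ g = ρ g * φ := fun g => by
    rw [hφ, sub_mul, mul_sub, Module.End.mul_eq_comp, hT g, smul_mul_assoc, mul_smul_comm]
    rfl
  obtain ⟨v, hv⟩ := hc.exists_hasEigenvector
  have hφv : φ v = 0 := by
    rw [hφ, LinearMap.sub_apply, hv.apply_eq_smul]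
    simp
  obtain ⟨ψ₀, hψ₀⟩ := φ.exists_generalized_inverse
  set ψ : V →ₗ[ℂ] V := (Fintype.card G : ℂ)⁻¹ • ∑ g, ρ g * ψ₀ * ρ g⁻¹ with hψ
  have hcard : (Fintype.card G : ℂ) ≠ 0 := by exact_mod_cast Fintype.card_ne_zero
  have hρ : ∀ g, ρ g * ρ g⁻¹ = 1 := fun g => by rw [← map_mul, mul_inv_cancel, map_one]
  have h1 : φ * ψ * φ = φ := by
    rw [hψ, mul_smul_comm, smul_mul_assoc, Finset.mul_sum, Finset.sum_mul]
    have : ∀ g ∈ Finset.univ, φ * (ρ g * ψ₀ * ρ g⁻¹) * φ = φ := fun g _ => by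
      calc φ * (ρ g * ψ₀ * ρ g⁻¹) * φ = (φ * ρ g) * ψ₀ * (ρ g⁻¹ * φ) := by simp only [mul_assoc]
        _ = ρ g * (φ * (ψ₀ * φ)) * ρ g⁻¹ := by rw [hφc, ← hφc g⁻¹]; simp only [mul_assoc]
        _ = φ := by
          change ρ g * (φ ∘ₗ ψ₀ ∘ₗ φ) * ρ g⁻¹ = φ
          rw [hψ₀, ← hφc, mul_assoc, hρ, mul_one]
    rw [Finset.sum_congr rfl this]
    simp [← Nat.cast_smul_eq_nsmul ℂ, smul_smul]
  have h2 : ∀ h, ψ * ρ h = ρ h * ψ := fun h => by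
    rw [hψ, mul_smul_comm, smul_mul_assoc, Finset.mul_sum, Finset.sum_mul]
    congr 1
    refine Fintype.sum_equiv (Equiv.mulLeft h⁻¹) _ _ fun g => ?_
    simp [mul_assoc, ← map_mul]
    rw [← mul_assoc (ρ h), ← map_mul, mul_inv_cancel_left]
  refine ⟨ψ * φ, ?_, fun g => ?_, ?_, ?_⟩
  · change ψ * φ * (ψ * φ) = ψ * φ
    rw [mul_assoc, ← mul_assoc φ, h1]
  · change ψ * φ * ρ g = ρ g * (ψ * φ)
    rw [mul_assoc, hφc, ← mul_assoc, h2, mul_assoc]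
  · intro h
    rw [mul_assoc, h, mul_zero] at h1
    exact hφ0 h1.symm
  · intro h
    have := LinearMap.congr_fun h v
    simp only [Module.End.mul_apply, hφv, map_zero, LinearMap.id_apply] at this
    exact hv.2 this.symm

end schur

theorem IsChar.exists_add [Finite G] {α : G → ℂ} (hα : IsChar G α) (h0 : α ≠ 0)
    (h1 : charInner G α α ≠ 1) :
    ∃ β γ : G → ℂ, IsChar G β ∧ IsChar G γ ∧ β 1 ≠ 0 ∧ γ 1 ≠ 0 ∧ α = β + γ := by
  obtain ⟨V, _, _, _, ρ, rfl⟩ := hα.exists_rep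
  have hT : ∃ T : V →ₗ[ℂ] V, (∀ g, T ∘ₗ ρ g = ρ g ∘ₗ T) ∧ ∀ c : ℂ, T ≠ c • LinearMap.id := by
    by_contra! hcon
    apply h1
    rw [charInner_rep]
    let I : ρ.IntertwiningMap ρ := ⟨LinearMap.id, fun g => rfl⟩
    have hI : I ≠ 0 := by
      intro hI0
      have hid : (LinearMap.id : V →ₗ[ℂ] V) = 0 :=
        congrArg Representation.IntertwiningMap.toLinearMap hI0
      apply h0
      funext g
      have : ρ g = 0 := LinearMap.ext fun v => LinearMap.congr_fun hid _
      simp [Representation.character, this]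
    have := (finrank_eq_one_iff_of_nonzero' I hI).2 fun w => by
      obtain ⟨c, hc⟩ := hcon w.toLinearMap w.2
      exact ⟨c, Representation.IntertwiningMap.ext hc.symm⟩
    rw [this, Nat.cast_one]
  obtain ⟨T, hT1, hT2⟩ := hT
  obtain ⟨e, he, hec, he0, he1⟩ := Representation.exists_idempotent hT1 hT2
  have he' : (LinearMap.id - e) ∘ₗ (LinearMap.id - e) = LinearMap.id - e := by
    rw [LinearMap.sub_comp, LinearMap.comp_sub, LinearMap.comp_sub, he]
    simp
  refine ⟨fun g => LinearMap.trace ℂ V (ρ g ∘ₗ e),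
    fun g => LinearMap.trace ℂ V (ρ g ∘ₗ (LinearMap.id - e)), ?_, ?_, ?_, ?_, ?_⟩
  · refine .of_idempotent (f := MonoidHom.id G) Function.surjective_id ρ e he hec ?_ fun g => rfl
    rintro g rfl
    rw [map_one]; rfl
  · refine .of_idempotent (f := MonoidHom.id G) Function.surjective_id ρ _ he' ?_ ?_ fun g => rfl
    · intro g
      rw [LinearMap.sub_comp, LinearMap.comp_sub, hec]; rfl
    · rintro g rfl
      rw [map_one]; rfl
  · change LinearMap.trace ℂ V (ρ 1 * e) ≠ 0
    rw [map_one, one_mul, Ne, LinearMap.IsIdempotentElem.trace_eq_zero_iff (show IsIdempotentElem e from he)]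
    exact he0
  · change LinearMap.trace ℂ V (ρ 1 * (LinearMap.id - e)) ≠ 0
    rw [map_one, one_mul, Ne, LinearMap.IsIdempotentElem.trace_eq_zero_iff (show IsIdempotentElem _ from he')]
    exact fun h => he1 (sub_eq_zero.1 h).symm
  · funext g
    simp only [Pi.add_apply]
    rw [← map_add, ← LinearMap.comp_add]
    simp [Representation.character]

theorem IsChar.exists_irr [Finite G] {f : G → ℂ} {α : G → ℂ} (hα : IsChar G α)
    (h : charInner G f α ≠ 0) : ∃ ξ, IsIrrChar G ξ ∧ charInner G f ξ ≠ 0 := by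
  obtain ⟨d, hd⟩ := hα.exists_degree
  induction d using Nat.strong_induction_on generalizing α with
  | _ d ih =>
    by_cases h1 : charInner G α α = 1
    · exact ⟨α, ⟨hα, h1⟩, h⟩
    have h0 : α ≠ 0 := by
      rintro rfl
      apply h
      have := charInner_smul_right 0 f 0
      simpa using this
    obtain ⟨β, γ, hβ, hγ, hβ0, hγ0, rfl⟩ := hα.exists_add h0 h1
    obtain ⟨b, hb⟩ := hβ.exists_degree
    obtain ⟨c, hc⟩ := hγ.exists_degree
    rw [Pi.add_apply, hb, hc] at hd
    have hd' : b + c = d := by exact_mod_cast hd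
    have hb0 : b ≠ 0 := by rintro rfl; simp [hb] at hβ0
    have hc0 : c ≠ 0 := by rintro rfl; simp [hc] at hγ0
    by_cases hfb : charInner G f β = 0
    · refine ih c (by omega) hγ ?_ hc
      intro hfc
      exact h (by rw [charInner_add_right, hfb, hfc, add_zero])
    · exact ih b (by omega) hβ hfb hb

/-- The ring of generalized characters of `G`, as an additive subgroup of the functions. -/
def genChars (G : Type) [Group G] : AddSubgroup (G → ℂ) :=
  AddSubgroup.closure {χ | IsChar G χ}

section genChars

variable {G H : Type} [Group G] [Group H]

theorem IsChar.mem_genChars {χ : G → ℂ} (h : IsChar G χ) : χ ∈ genChars G :=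
  AddSubgroup.subset_closure h

theorem genChars_mul_mem {φ ψ : G → ℂ} (hφ : φ ∈ genChars G) (hψ : ψ ∈ genChars G) :
    φ * ψ ∈ genChars G := by
  induction hφ using AddSubgroup.closure_induction with
  | mem α hα =>
    induction hψ using AddSubgroup.closure_induction with
    | mem β hβ => exact (IsChar.mul hα hβ).mem_genChars
    | zero => rw [mul_zero]; exact zero_mem _
    | add x y _ _ hx hy => rw [mul_add]; exact add_mem hx hy
    | neg x _ hx => rw [mul_neg]; exact neg_mem hx
  | zero => rw [zero_mul]; exact zero_mem _
  | add x y _ _ hx hy => rw [add_mul]; exact add_mem hx hy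
  | neg x _ hx => rw [neg_mul]; exact neg_mem hx

theorem genChars_comp_mem {φ : G → ℂ} (hφ : φ ∈ genChars G) (f : H →* G) :
    (fun h => φ (f h)) ∈ genChars H := by
  induction hφ using AddSubgroup.closure_induction with
  | mem α hα => exact (IsChar.comp hα f).mem_genChars
  | zero => exact zero_mem _
  | add x y _ _ hx hy => exact add_mem hx hy
  | neg x _ hx => exact neg_mem hx

theorem genChars_charInner_int [Finite G] {φ β : G → ℂ} (hφ : φ ∈ genChars G) (hβ : IsChar G β) :
    ∃ z : ℤ, charInner G φ β = z := by
  induction hφ using AddSubgroup.closure_induction with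
  | mem α hα =>
    obtain ⟨n, hn⟩ := IsChar.charInner_nat hα hβ
    exact ⟨n, by simp [hn]⟩
  | zero =>
    refine ⟨0, ?_⟩
    have := charInner_smul_left 0 0 β
    simpa using this
  | add x y _ _ hx hy =>
    obtain ⟨a, ha⟩ := hx
    obtain ⟨b, hb⟩ := hy
    exact ⟨a + b, by rw [charInner_add_left, ha, hb, Int.cast_add]⟩
  | neg x _ hx =>
    obtain ⟨a, ha⟩ := hx
    exact ⟨-a, by rw [charInner_neg_left, ha, Int.cast_neg]⟩

theorem genChars_exists_irr [Finite G] {f φ : G → ℂ} (hφ : φ ∈ genChars G)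
    (h : charInner G f φ ≠ 0) : ∃ ξ, IsIrrChar G ξ ∧ charInner G f ξ ≠ 0 := by
  by_contra! hcon
  apply h
  induction hφ using AddSubgroup.closure_induction with
  | mem α hα =>
    by_contra h0
    obtain ⟨ξ, h1, h2⟩ := IsChar.exists_irr hα h0
    exact h2 (hcon ξ h1)
  | zero =>
    have := charInner_smul_right 0 f 0
    simpa using this
  | add x y _ _ hx hy => 
    by_cases hx0 : charInner G f x = 0
    · by_cases hy0 : charInner G f y = 0
      · rw [charInner_add_right, hx0, hy0, add_zero]
      · exact absurd (hy hy0) hy0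
    · exact absurd (hx hx0) hx0
  | neg x _ hx =>
    have h2 := charInner_sub_right f 0 x
    have h3 := charInner_smul_right 0 f 0
    by_cases hx0 : charInner G f x = 0
    · simp only [zero_smul, map_zero, zero_mul] at h3
      rw [← zero_sub, h2, h3, hx0, sub_zero]
    · exact absurd (hx hx0) hx0

/-- A class function of norm one, some multiple of which is a generalized character, and whose
inner products with irreducible characters are integers, is an irreducible character as soon as
its degree is a natural number. -/
theorem isIrrChar_of_genChars [Finite G] {f : G → ℂ} {c : ℂ} (hc : c ≠ 0)
    (hf : c • f ∈ genChars G) (h1 : charInner G f f = 1)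
    (hint : ∀ ξ, IsIrrChar G ξ → charInner G f ξ ≠ 0 → ∃ z : ℤ, charInner G f ξ = z)
    (hd : ∃ d : ℕ, f 1 = d) : IsIrrChar G f := by
  obtain ⟨ξ, hξ, hfξ⟩ := genChars_exists_irr (f := f) hf (by
    rw [charInner_smul_right, h1, mul_one]
    simpa using hc)
  obtain ⟨m, hm⟩ := hint ξ hξ hfξ
  have hm0 : m ≠ 0 := by
    rintro rfl
    simp [hm] at hfξ
  have hξf : charInner G ξ f = m := by rw [← charInner_conj_symm, hm]; simp
  have hsq : (0 : ℤ) < m ^ 2 := by positivity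
  have hz := eq_zero_of_charInner_self_nonpos (φ := f - (m : ℂ) • ξ) (r := 1 - (m : ℝ) ^ 2) (by
    rw [charInner_sub_left, charInner_sub_right, charInner_sub_right, charInner_smul_left,
      charInner_smul_left, charInner_smul_right, charInner_smul_right, h1, hm, hξf, hξ.2]
    simp
    ring) (by
    have : (1 : ℝ) ≤ (m : ℝ) ^ 2 := by exact_mod_cast hsq
    linarith)
  have hfm : f = (m : ℂ) • ξ := sub_eq_zero.1 hz
  have hm1 : m ^ 2 = 1 := by
    have : charInner G f f = (m : ℂ) * m := by
      conv_lhs => rw [hfm]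
      rw [charInner_smul_left, charInner_smul_right, hξ.2]
      simp
    rw [h1] at this
    rw [pow_two]
    exact_mod_cast this.symm
  obtain ⟨d, hd⟩ := hd
  obtain ⟨b, hb⟩ := hξ.1.exists_degree
  rcases (show m = 1 ∨ m = -1 by simpa using hm1) with h | h
  · rw [hfm, h]
    simpa using hξ
  · exfalso
    have hb0 : b ≠ 0 := by
      rintro rfl
      have := hξ.1.eq_zero (by simpa using hb)
      have h2 := charInner_smul_left 0 (0 : G → ℂ) 0
      have h3 := hξ.2
      rw [this] at h3
      simp [h3] at h2
    have h5 : f 1 = m * b := by rw [hfm]; simp [hb]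
    rw [hd, h] at h5
    have h6 : (d : ℤ) = -1 * b := by exact_mod_cast h5
    omega

end genChars

section cyclic

variable {ι R : Type} [Fintype ι] [DecidableEq ι] [CommRing R]

theorem Matrix.pow_succ_apply (A : Matrix ι ι R) (n : ℕ) (x y : ι) :
    (A ^ (n + 1)) x y = ∑ u : Fin n → ι, ∏ i : Fin (n + 1),
      A ((Fin.cons x u : Fin (n + 1) → ι) i) ((Fin.snoc u y : Fin (n + 1) → ι) i) := by
  induction n generalizing x with
  | zero => simp [Fin.snoc]
  | succ n ih =>
    rw [pow_succ' A (n + 1), Matrix.mul_apply,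
      ← Fintype.sum_equiv (Fin.consEquiv fun _ : Fin (n + 1) => ι)
        (fun zu => ∏ i : Fin (n + 2), A ((Fin.cons x (Fin.cons zu.1 zu.2 : Fin (n + 1) → ι) : Fin (n + 2) → ι) i)
          ((Fin.snoc (Fin.cons zu.1 zu.2 : Fin (n + 1) → ι) y : Fin (n + 2) → ι) i)) _
          (fun _ => rfl),
      Fintype.sum_prod_type]
    refine Finset.sum_congr rfl fun z _ => ?_
    rw [ih, Finset.mul_sum]
    refine Finset.sum_congr rfl fun u _ => ?_
    rw [Fin.prod_univ_succ (n := n + 1), ← Fin.cons_snoc_eq_snoc_cons]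
    simp

theorem Matrix.trace_pow_succ (A : Matrix ι ι R) (n : ℕ) :
    (A ^ (n + 1)).trace = ∑ u : Fin (n + 1) → ι, ∏ i, A (u i) (u (i + 1)) := by
  rw [Matrix.trace, ← Fintype.sum_equiv (Fin.consEquiv fun _ : Fin (n + 1) => ι)
        (fun zu => ∏ i, A ((Fin.cons zu.1 zu.2 : Fin (n + 1) → ι) i)
          ((Fin.cons zu.1 zu.2 : Fin (n + 1) → ι) (i + 1))) _
          (fun _ => rfl),
      Fintype.sum_prod_type]
  refine Finset.sum_congr rfl fun x _ => ?_
  rw [Matrix.diag_apply, Matrix.pow_succ_apply]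
  refine Finset.sum_congr rfl fun u _ => Finset.prod_congr rfl fun i _ => ?_
  congr 1
  refine Fin.lastCases ?_ (fun j => ?_) i
  · simp
  · simp [Fin.coeSucc_eq_succ]

theorem Matrix.sum_prod_cycle (A : Matrix ι ι R) (p : ℕ) [hp : Fact p.Prime] {c : ZMod p}
    (hc : c ≠ 0) : ∑ u : ZMod p → ι, ∏ i, A (u i) (u (i + c)) = (A ^ p).trace := by
  have h1 : ∑ u : ZMod p → ι, ∏ i, A (u i) (u (i + 1)) = (A ^ p).trace := by
    obtain ⟨n, rfl⟩ := Nat.exists_eq_succ_of_ne_zero hp.out.ne_zero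
    exact (Matrix.trace_pow_succ A n).symm
  rw [← h1]
  let e : ZMod p ≃ ZMod p := Equiv.mulLeft₀ c hc
  refine Fintype.sum_equiv (Equiv.arrowCongr e.symm (Equiv.refl ι)) _ _ fun u => ?_
  refine Fintype.prod_equiv e.symm _ _ fun i => ?_
  have h2 : e (e.symm i + 1) = i + c := by
    change c * (e.symm i + 1) = _
    rw [mul_add, mul_one]
    congr 1
    exact e.apply_symm_apply i
  simp [Equiv.arrowCongr, h2]

/-- The tensor power of a matrix representation, extended by cyclic permutations of the factors. -/
def Matrix.cyclicPower {G : Type} [Group G] (A : G →* Matrix ι ι R) (p : ℕ) [NeZero p] :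
    G × Multiplicative (ZMod p) →* Matrix (ZMod p → ι) (ZMod p → ι) R where
  toFun x := Matrix.of fun u v => ∏ i, A x.1 (u i) (v (i + x.2.toAdd))
  map_one' := by
    ext u v
    simp only [Prod.fst_one, map_one, Prod.snd_one, toAdd_one, add_zero, Matrix.of_apply,
      Matrix.one_apply, Finset.prod_ite_zero, Finset.prod_const_one, funext_iff, Finset.mem_univ,
      true_imp_iff]
  map_mul' x y := by
    ext u w
    simp only [Prod.fst_mul, map_mul, Prod.snd_mul, toAdd_mul, Matrix.of_apply,
      Matrix.mul_apply]
    rw [Finset.prod_univ_sum, Fintype.piFinset_univ]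
    symm
    refine Fintype.sum_equiv (Equiv.arrowCongr (Equiv.addRight x.2.toAdd).symm (Equiv.refl ι)) _ _
      fun v => ?_
    rw [Finset.prod_mul_distrib]
    congr 1
    refine Fintype.prod_equiv (Equiv.addRight x.2.toAdd).symm _ _ fun i => ?_
    simp [Equiv.arrowCongr, ← add_assoc]

end cyclic

section adams

variable {G : Type} [Group G]

theorem IsChar.of_hom (f : G →* ℂ) : IsChar G f :=
  .of_matrix (n := Unit) ((Matrix.scalar Unit : ℂ →+* _).toMonoidHom.comp f) fun g => by
    simp [Matrix.trace]

theorem IsChar.average_snd [Finite G] {C : Type} [Group C] [Fintype C] {α : G × C → ℂ}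
    (hα : IsChar (G × C) α) :
    IsChar G fun g => (Nat.card C : ℂ)⁻¹ * ∑ c, α (g, c) := by
  cases nonempty_fintype G
  have := Fintype.ofFinite (MonoidHom.fst G C).ker
  let e : C ≃ (MonoidHom.fst G C).ker :=
    { toFun := fun c => ⟨(1, c), rfl⟩
      invFun := fun k => k.1.2
      left_inv := fun _ => rfl
      right_inv := fun k => Subtype.ext (Prod.ext k.2.symm rfl) }
  refine hα.average (f := MonoidHom.fst G C) (fun g => ⟨(g, 1), rfl⟩) fun g => ?_
  rw [← Nat.card_congr e]
  congr 1
  refine Fintype.sum_equiv ((Equiv.mulLeft g.2⁻¹).trans e) _ _ fun c => ?_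
  change _ = α (g * (1, g.2⁻¹ * c))
  congr 1
  ext <;> simp

theorem IsChar.mem_genChars_of_twist [Finite G] {C : Type} [Group C] [Fintype C]
    {τ : G × C → ℂ} (hτ : IsChar (G × C) τ) (ω : C →* ℂ) (hω : ∑ c, ω c = 0) {ψ : G → ℂ}
    (h : ∀ g c, c ≠ 1 → τ (g, c) = ψ g) : ψ ∈ genChars G := by
  have hσ : IsChar (G × C) (τ * fun x => ω x.2) :=
    hτ.mul (.of_hom (ω.comp (MonoidHom.snd G C)))
  have key : ψ = (fun g => (Nat.card C : ℂ)⁻¹ * ∑ c, τ (g, c)) -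
      fun g => (Nat.card C : ℂ)⁻¹ * ∑ c, (τ * fun x : G × C => ω x.2) (g, c) := by
    funext g
    have h1 : ∀ c : C, τ (g, c) - τ (g, c) * ω c = ψ g - ψ g * ω c := fun c => by
      by_cases hc : c = 1
      · subst hc; simp
      · rw [h g c hc]
    rw [Pi.sub_apply, ← mul_sub, ← Finset.sum_sub_distrib]
    simp only [Pi.mul_apply, h1]
    rw [Finset.sum_sub_distrib, ← Finset.mul_sum, hω]
    simp
  rw [key]
  exact sub_mem hτ.average_snd.mem_genChars hσ.average_snd.mem_genChars

theorem IsChar.adams_prime_mem [Finite G] {χ : G → ℂ} (hχ : IsChar G χ) (p : ℕ)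
    [hp : Fact p.Prime] : (fun g => χ (g ^ p)) ∈ genChars G := by
  obtain ⟨d, A, hA⟩ := hχ.exists_matrix
  have hω : ∑ c : Multiplicative (ZMod p), ZMod.stdAddChar.toMonoidHom c = 0 := by
    have h2 : ∑ c : ZMod p, ZMod.stdAddChar c = 0 := by
      refine AddChar.sum_eq_zero_of_ne_one fun h3 => ?_
      have h4 := ZMod.isPrimitive_stdAddChar p one_ne_zero
      apply h4
      ext c
      rw [AddChar.mulShift_apply, one_mul]
      exact DFunLike.congr_fun h3 c
    exact (Fintype.sum_equiv Multiplicative.toAdd _ _ fun _ => rfl).trans h2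
  refine IsChar.mem_genChars_of_twist (C := Multiplicative (ZMod p))
    (τ := fun x => (Matrix.cyclicPower A p x).trace)
    (.of_matrix (Matrix.cyclicPower A p) fun _ => rfl) _ hω fun g c hc => ?_
  rw [hA, map_pow, ← Matrix.sum_prod_cycle (A g) p (c := c.toAdd) hc]
  rfl

theorem genChars_apply_one {φ : G → ℂ} (hφ : φ ∈ genChars G) : ∃ z : ℤ, φ 1 = z := by
  induction hφ using AddSubgroup.closure_induction with
  | mem α hα =>
    obtain ⟨d, hd⟩ := IsChar.exists_degree hα
    exact ⟨d, by simp [hd]⟩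
  | zero => exact ⟨0, by simp⟩
  | add x y _ _ hx hy =>
    obtain ⟨a, ha⟩ := hx
    obtain ⟨b, hb⟩ := hy
    exact ⟨a + b, by simp [ha, hb]⟩
  | neg x _ hx =>
    obtain ⟨a, ha⟩ := hx
    exact ⟨-a, by simp [ha]⟩

theorem genChars_adams_mem [Finite G] {φ : G → ℂ} (hφ : φ ∈ genChars G) (k : ℕ) :
    (fun g => φ (g ^ k)) ∈ genChars G := by
  induction k using Nat.recOnMul generalizing φ with
  | zero =>
    obtain ⟨z, hz⟩ := genChars_apply_one hφ
    have : (fun g => φ (g ^ 0)) = z • (1 : G → ℂ) := by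
      funext g
      simp [hz]
    rw [this]
    exact zsmul_mem IsChar.one.mem_genChars z
  | one => simpa using hφ
  | prime p hp =>
    have := Fact.mk hp
    induction hφ using AddSubgroup.closure_induction with
    | mem α hα => exact IsChar.adams_prime_mem hα p
    | zero => exact zero_mem _
    | add x y _ _ hx hy => exact add_mem hx hy
    | neg x _ hx => exact neg_mem hx
  | mul a b ha hb =>
    have := hb (ha hφ)
    simpa [pow_mul'] using this

end adams

section permChar

variable {Q : Type} [Group Q]

open Classical in
theorem Subgroup.isChar_permutation [Finite Q] (S : Subgroup Q) :
    IsChar Q fun x => (Nat.card {c : Q ⧸ S // c = x • c} : ℂ) := by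
  have := Fintype.ofFinite (Q ⧸ S)
  let A : Q →* Matrix (Q ⧸ S) (Q ⧸ S) ℂ :=
    { toFun := fun x => Matrix.of fun i j => if i = x • j then 1 else 0
      map_one' := by
        ext i j
        simp [Matrix.one_apply]
      map_mul' := fun x y => by
        ext i j
        simp [Matrix.mul_apply, mul_smul] }
  refine .of_matrix A fun x => ?_
  simp [A, Matrix.trace, Fintype.card_subtype]

open Classical in
theorem Subgroup.permutation_adams_mem [Finite Q] (S : Subgroup Q) (j : ℕ)
    (hS : ∀ x : Q, x ^ j ∈ S → x ^ j = 1) :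
    (fun x : Q => if x ^ j = 1 then (S.index : ℂ) else 0) ∈ genChars Q := by
  have h := genChars_adams_mem (S.isChar_permutation).mem_genChars j
  convert h using 2 with x
  split_ifs with hx
  · simp only [hx, one_smul]
    rw [S.index_eq_card]
    congr 1
    exact Nat.card_congr (Equiv.subtypeUnivEquiv fun _ => trivial).symm
  · have : IsEmpty {c : Q ⧸ S // c = x ^ j • c} := by
      refine ⟨fun ⟨c, hc⟩ => hx ?_⟩
      induction c using QuotientGroup.induction_on with
      | H q =>
        have h1 : q⁻¹ * (x ^ j * q) ∈ S := QuotientGroup.eq.1 hc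
        have h2 : q⁻¹ * (x ^ j * q) = (q⁻¹ * x * q⁻¹⁻¹) ^ j := by rw [conj_pow]; group
        rw [h2] at h1
        have h3 := hS _ h1
        rwa [conj_pow, conj_eq_one_iff] at h3
    simp

end permChar

section integrality

variable {G : Type} [Group G] [Finite G]

theorem IsChar.isIntegral {χ : G → ℂ} (h : IsChar G χ) (g : G) : IsIntegral ℤ (χ g) := by
  obtain ⟨V, _, _, _, ρ, rfl⟩ := h.exists_rep
  rw [Representation.character,
    Module.End.trace_eq_sum_roots_charpoly_of_splits (IsAlgClosed.splits _)]
  refine IsIntegral.multiset_sum fun r hr => ?_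
  have h1 := (Module.End.hasEigenvalue_iff_isRoot_charpoly _ _).2 (Polynomial.isRoot_of_mem_roots hr)
  obtain ⟨v, hv⟩ := h1.exists_hasEigenvector
  have h2 : (ρ g ^ Nat.card G) v = r ^ Nat.card G • v := hv.pow_apply _
  rw [← map_pow, pow_card_eq_one', map_one, Module.End.one_apply] at h2
  refine IsIntegral.of_pow (n := Nat.card G) Nat.card_pos ?_
  have h3 : (r ^ Nat.card G - 1) • v = 0 := by rw [sub_smul, one_smul, ← h2, sub_self]
  rcases smul_eq_zero.1 h3 with h4 | h4
  · rw [sub_eq_zero.1 h4]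
    exact isIntegral_one
  · exact absurd h4 hv.2

theorem IsIntegral.conj {z : ℂ} (hz : IsIntegral ℤ z) : IsIntegral ℤ (conj z) :=
  hz.map (starRingEnd ℂ).toIntAlgHom

/-- A scalar acting as an integral combination of group elements is integral. -/
theorem Representation.isIntegral_of_sum_eq_smul {V : Type} [AddCommGroup V] [Module ℂ V]
    [Nontrivial V] (ρ : Representation ℂ G V) {ι : Type} [Fintype ι] (a : ι → ℂ)
    (ha : ∀ i, IsIntegral ℤ (a i)) (x : ι → G) {c : ℂ}
    (h : ∑ i, a i • ρ (x i) = c • LinearMap.id) : IsIntegral ℤ c := by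
  let O := integralClosure ℤ ℂ
  let φ : MonoidAlgebra O G →ₐ[O] Module.End ℂ V := MonoidAlgebra.lift O (Module.End ℂ V) G ρ
  let t : MonoidAlgebra O G := ∑ i, MonoidAlgebra.single (x i) (⟨a i, ha i⟩ : O)
  have ht : φ t = algebraMap ℂ (Module.End ℂ V) c := by
    have h1 : algebraMap ℂ (Module.End ℂ V) c = c • LinearMap.id := rfl
    rw [h1, ← h, map_sum]
    refine Finset.sum_congr rfl fun i _ => ?_
    simp only [φ, MonoidAlgebra.lift_single]
    rfl
  have : Module.Finite O (MonoidAlgebra O G) := inferInstance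
  have h1 : IsIntegral O (φ t) := (Algebra.IsIntegral.isIntegral (R := O) t).map φ
  rw [ht] at h1
  have h2 : IsIntegral O c := (isIntegral_algHom_iff
    ((Algebra.ofId ℂ (Module.End ℂ V)).restrictScalars O)
    (algebraMap ℂ (Module.End ℂ V)).injective).1 h1
  exact isIntegral_trans c h2

end integrality

section fiber

variable {E Q : Type} [Group E] [Group Q]

theorem MonoidHom.sum_comp_eq [Fintype E] [Fintype Q] {M : Type} [AddCommMonoid M] {h : E →* Q}
    (hh : Function.Surjective h) (F : Q → M) :
    ∑ e, F (h e) = Nat.card h.ker • ∑ x, F x := by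
  classical
  rw [← Finset.sum_fiberwise (s := Finset.univ) (g := h), Finset.smul_sum]
  refine Finset.sum_congr rfl fun x _ => ?_
  rw [Finset.sum_congr rfl (g := fun _ => F x) (by simp +contextual), Finset.sum_const]
  congr 1
  rw [MonoidHom.card_fiber_eq_of_mem_range h (hh x) ⟨1, map_one h⟩, Nat.card_eq_fintype_card,
    Fintype.card_subtype]
  congr

theorem MonoidHom.card_eq_of_surjective [Finite E] {h : E →* Q}
    (hh : Function.Surjective h) : Nat.card E = Nat.card h.ker * Nat.card Q := by
  rw [← Subgroup.card_mul_index h.ker, Subgroup.index_ker, MonoidHom.range_eq_top.2 hh,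
    Subgroup.card_top]

theorem charInner_comp [Finite E] [Finite Q] {h : E →* Q}
    (hh : Function.Surjective h) (φ ψ : Q → ℂ) :
    charInner E (fun e => φ (h e)) (fun e => ψ (h e)) = charInner Q φ ψ := by
  cases nonempty_fintype E
  cases nonempty_fintype Q
  rw [charInner_eq_sum, charInner_eq_sum, MonoidHom.sum_comp_eq hh (fun x => φ x * conj (ψ x)),
    MonoidHom.card_eq_of_surjective hh, nsmul_eq_mul]
  have : (Nat.card h.ker : ℂ) ≠ 0 := by exact_mod_cast Nat.card_pos.ne'
  push_cast
  field_simp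

theorem IsIrrChar.degree_ne_zero [Finite E] {s : E → ℂ} (hs : IsIrrChar E s) : s 1 ≠ 0 := by
  intro h0
  have h1 := hs.2
  rw [hs.1.eq_zero h0] at h1
  have := charInner_smul_left 0 (0 : E → ℂ) 0
  simp [h1] at this

theorem IsIrrChar.exists_central [Finite E] {V : Type} [AddCommGroup V] [Module ℂ V]
    [FiniteDimensional ℂ V] {ρ : Representation ℂ E V}
    (hρ : charInner E ρ.character ρ.character = 1) {z : E} (hz : ∀ e, z * e = e * z) :
    ∃ c : ℂ, ρ z = c • LinearMap.id := by
  refine Representation.exists_eq_smul_of_commute hρ fun g => ?_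
  change ρ z * ρ g = ρ g * ρ z
  rw [← map_mul, hz, map_mul]

theorem IsIrrChar.isIntegral_charInner [Finite E] [Finite Q] {h : E →* Q}
    (hh : Function.Surjective h) (hker : ∀ z ∈ h.ker, ∀ e, z * e = e * z) {l : E → ℂ}
    (hl : ∀ z ∈ h.ker, l z * conj (l z) = 1) {s : E → ℂ} (hs : IsIrrChar E s)
    (hsl : ∀ e, ∀ z ∈ h.ker, s (e * z) = l z * s e) {w : E → ℂ}
    (hw : ∀ e f, w (f * e * f⁻¹) = w e) (hwi : ∀ e, IsIntegral ℤ (w e))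
    (hwl : ∀ e, ∀ z ∈ h.ker, w (e * z) = l z * w e) :
    IsIntegral ℤ (Nat.card Q / s 1 * charInner E s w) := by
  cases nonempty_fintype E
  cases nonempty_fintype Q
  have hs1 := hs.degree_ne_zero
  obtain ⟨V, _, _, _, ρ, rfl⟩ := hs.1.exists_rep
  have hV : Nontrivial V := by
    by_contra hcon
    rw [not_nontrivial_iff_subsingleton] at hcon
    apply hs1
    rw [Representation.char_one, Module.finrank_zero_of_subsingleton, Nat.cast_zero]
  have hρz : ∀ z ∈ h.ker, ρ z = l z • LinearMap.id := fun z hz => by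
    obtain ⟨c, hc⟩ := IsIrrChar.exists_central hs.2 (hker z hz)
    have h1 := hsl 1 z hz
    rw [one_mul] at h1
    have h2 : ρ.character z = c * ρ.character 1 := by
      simp [Representation.character, hc]
    rw [hc, mul_right_cancel₀ hs1 (h2.symm.trans h1)]
  let u : Q → E := Function.surjInv hh
  have hu : ∀ x, h (u x) = x := Function.surjInv_eq hh
  let F : E → Module.End ℂ V := fun e => conj (w e) • ρ e
  have hF : ∀ e, F (u (h e)) = F e := fun e => by
    have hk : e⁻¹ * u (h e) ∈ h.ker := by simp [MonoidHom.mem_ker, hu]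
    have h1 : u (h e) = e * (e⁻¹ * u (h e)) := by group
    have h2 : ρ (u (h e)) = l (e⁻¹ * u (h e)) • ρ e := by
      conv_lhs => rw [h1, map_mul, hρz _ hk]
      rw [mul_smul_comm]
      rfl
    have h3 : w (u (h e)) = l (e⁻¹ * u (h e)) * w e := by
      conv_lhs => rw [h1, hwl _ _ hk]
    simp only [F]
    rw [h2, h3, smul_smul, map_mul, mul_right_comm, mul_comm (conj _), hl _ hk, one_mul]
  set T : Module.End ℂ V := ∑ x, F (u x) with hT
  have hTE : ∑ e, F e = Nat.card h.ker • T := by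
    rw [hT, ← MonoidHom.sum_comp_eq hh (fun x => F (u x))]
    exact Finset.sum_congr rfl fun e _ => (hF e).symm
  have hk0 : (Nat.card h.ker : ℂ) ≠ 0 := by exact_mod_cast Nat.card_pos.ne'
  have hcomm : ∀ g, T ∘ₗ ρ g = ρ g ∘ₗ T := fun g => by
    have h1 : (∑ e, F e) * ρ g = ρ g * ∑ e, F e := by
      rw [Finset.sum_mul, Finset.mul_sum]
      refine Fintype.sum_equiv (MulAut.conj g⁻¹).toEquiv _ _ fun e => ?_
      simp only [F, MulEquiv.toEquiv_eq_coe, EquivLike.coe_coe, MulAut.conj_apply, hw]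
      rw [smul_mul_assoc, mul_smul_comm, ← map_mul, ← map_mul]
      congr 2
      group
    rw [hTE, ← Nat.cast_smul_eq_nsmul ℂ, smul_mul_assoc, mul_smul_comm] at h1
    exact smul_right_injective _ hk0 h1
  obtain ⟨c, hc⟩ := Representation.exists_eq_smul_of_commute hs.2 hcomm
  have hci : IsIntegral ℤ c :=
    ρ.isIntegral_of_sum_eq_smul (fun x => conj (w (u x))) (fun x => (hwi _).conj) u hc
  have h1 : Nat.card E * charInner E ρ.character w = Nat.card h.ker * (c * ρ.character 1) := by
    have hE0 : (Nat.card E : ℂ) ≠ 0 := by exact_mod_cast Nat.card_pos.ne'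
    have h2 := congrArg (LinearMap.trace ℂ V) hTE
    rw [hc, map_sum, map_nsmul, map_smul, nsmul_eq_mul] at h2
    rw [charInner_eq_sum, mul_inv_cancel_left₀ hE0, Representation.character, map_one]
    refine Eq.trans (Finset.sum_congr rfl fun e _ => ?_) h2
    simp [F, Representation.character, mul_comm]
  rw [MonoidHom.card_eq_of_surjective hh, Nat.cast_mul, mul_assoc] at h1
  have h2 := mul_left_cancel₀ hk0 h1
  have h3 : Nat.card Q / ρ.character 1 * charInner E ρ.character w = c := by
    rw [div_mul_eq_mul_div, h2, mul_div_assoc, div_self hs1, mul_one]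
  rwa [h3]

end fiber

theorem exists_int_of_isIntegral {c : ℂ} (r : ℚ) (hr : c = r) (hc : IsIntegral ℤ c) :
    ∃ z : ℤ, c = z := by
  subst hr
  have h1 : IsIntegral ℤ r := (isIntegral_algebraMap_iff (algebraMap ℚ ℂ).injective).1 hc
  obtain ⟨z, hz⟩ := IsIntegrallyClosed.isIntegral_iff.1 h1
  exact ⟨z, by rw [← hz]; simp⟩

theorem Rat.den_dvd_of_mul_eq_intCast {r : ℚ} {n : ℕ} {z : ℤ} (h : n * r = z) : r.den ∣ n := by
  have h1 : ((n * r.num : ℤ) : ℚ) = (z * r.den : ℤ) := by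
    push_cast
    rw [← h, mul_assoc, Rat.mul_den_eq_num]
  have h2 : (n * r.num : ℤ) = z * r.den := by exact_mod_cast h1
  have h3 : (r.den : ℤ) ∣ n * r.num := ⟨z, by rw [h2, mul_comm]⟩
  have h4 : r.den ∣ n * r.num.natAbs := by
    have := Int.natAbs_dvd_natAbs.2 h3
    simpa [Int.natAbs_mul] using this
  exact Nat.Coprime.dvd_of_dvd_mul_right r.reduced.symm h4

theorem exists_int_of_index_mul {Q : Type} [Group Q] [Finite Q] (π : Set ℕ) {c : ℂ} {B : ℕ}
    (hB : ∀ q : ℕ, q.Prime → q ∣ B → q ∉ π) (hBc : IsIntegral ℤ (B * c))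
    (hS : ∀ S : Subgroup Q, (∀ q : ℕ, q.Prime → q ∣ Nat.card S → q ∉ π) →
      ∃ z : ℤ, S.index * c = z) : ∃ z : ℤ, c = z := by
  obtain ⟨z, hz⟩ := hS ⊥ (by simp +contextual [Nat.Prime.ne_one])
  rw [Subgroup.index_bot] at hz
  have hQ0 : (Nat.card Q : ℂ) ≠ 0 := by exact_mod_cast Nat.card_pos.ne'
  obtain ⟨r, rfl⟩ : ∃ r : ℚ, c = r := ⟨z / Nat.card Q, by
    push_cast
    rw [eq_div_iff hQ0, mul_comm, hz]⟩
  have hrB : r.den ∣ B := by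
    obtain ⟨y, hy⟩ := exists_int_of_isIntegral (B * r) (by push_cast; rfl) hBc
    exact Rat.den_dvd_of_mul_eq_intCast (z := y) (by exact_mod_cast hy)
  have hden : r.den = 1 := by
    by_contra hne
    obtain ⟨q, hq, hqd⟩ := Nat.exists_prime_and_dvd hne
    have hqπ := hB q hq (hqd.trans hrB)
    have := Fact.mk hq
    obtain ⟨P⟩ : Nonempty (Sylow q Q) := inferInstance
    obtain ⟨k, hk⟩ := P.isPGroup'.exists_card_eq
    obtain ⟨y, hy⟩ := hS P fun q' hq' hd => by
      rw [hk] at hd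
      rwa [(Nat.prime_dvd_prime_iff_eq hq' hq).1 (hq'.dvd_of_dvd_pow hd)]
    exact P.not_dvd_index (hqd.trans (Rat.den_dvd_of_mul_eq_intCast (z := y) (by exact_mod_cast hy)))
  exact ⟨r.num, by rw [← Rat.coe_int_num_of_den_eq_one hden]; simp⟩

section piPart

variable (π : Set ℕ) {n : ℕ}

open Classical in
theorem Nat.factorization_piPart (n : ℕ) :
    (Nat.piPart π n).factorization = n.factorization.filter (· ∈ π) := by
  have h : Nat.piPart π n = (n.factorization.filter (· ∈ π)).prod (· ^ ·) := by
    rw [Nat.piPart, Finsupp.prod, Finsupp.prod_filter_index, Finsupp.support_filter,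
      Finset.prod_filter]
  rw [h]
  refine Nat.prod_pow_factorization_eq_self fun p hp => ?_
  rw [Finsupp.support_filter, Finset.mem_filter] at hp
  exact Nat.prime_of_mem_primeFactors hp.1

theorem Nat.piPart_ne_zero (n : ℕ) : Nat.piPart π n ≠ 0 := by
  classical
  rw [Nat.piPart, Finsupp.prod, Finset.prod_ne_zero_iff]
  intro p hp
  split_ifs
  · exact pow_ne_zero _ (Nat.prime_of_mem_primeFactors hp).ne_zero
  · exact one_ne_zero

theorem Nat.piPart_dvd (hn : n ≠ 0) : Nat.piPart π n ∣ n := by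
  classical
  rw [← Nat.factorization_le_iff_dvd (Nat.piPart_ne_zero π n) hn, Nat.factorization_piPart]
  intro p
  rw [Finsupp.filter_apply]
  split_ifs <;> simp

theorem Nat.mem_of_dvd_piPart {q : ℕ} (hq : q.Prime) (h : q ∣ Nat.piPart π n) : q ∈ π := by
  classical
  have h1 := hq.factorization_pos_of_dvd (Nat.piPart_ne_zero π n) h
  rw [Nat.factorization_piPart, Finsupp.filter_apply] at h1
  by_contra hcon
  simp [hcon] at h1

theorem Nat.notMem_of_dvd_div_piPart (hn : n ≠ 0) {q : ℕ} (hq : q.Prime)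
    (h : q ∣ n / Nat.piPart π n) : q ∉ π := by
  classical
  intro hqπ
  have hd := Nat.piPart_dvd π hn
  have h0 : n / Nat.piPart π n ≠ 0 :=
    (Nat.div_pos (Nat.le_of_dvd (Nat.pos_of_ne_zero hn) hd)
      (Nat.pos_of_ne_zero (Nat.piPart_ne_zero π n))).ne'
  have h1 := hq.factorization_pos_of_dvd h0 h
  rw [Nat.factorization_div hd, Nat.factorization_piPart, Finsupp.tsub_apply,
    Finsupp.filter_apply, if_pos hqπ, Nat.sub_self] at h1
  exact h1.ne rfl

end piPart

theorem genChars_descend {E Q : Type} [Group E] [Finite E] [Group Q] {h : E →* Q}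
    (hh : Function.Surjective h) {f : Q → ℂ} (hf : (fun e => f (h e)) ∈ genChars E) :
    f ∈ genChars Q := by
  cases nonempty_fintype E
  have := Fintype.ofFinite h.ker
  let u : Q → E := Function.surjInv hh
  have hu : ∀ x, h (u x) = x := Function.surjInv_eq hh
  have key : ∀ φ ∈ genChars E,
      (fun x => (Nat.card h.ker : ℂ)⁻¹ * ∑ k : h.ker, φ (u x * k)) ∈ genChars Q := by
    intro φ hφ
    induction hφ using AddSubgroup.closure_induction with
    | mem α hα =>
      refine (IsChar.average hh hα fun g => ?_).mem_genChars
      congr 1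
      have hk : g⁻¹ * u (h g) ∈ h.ker := by simp [MonoidHom.mem_ker, hu]
      refine Fintype.sum_equiv (Equiv.mulLeft (⟨_, hk⟩ : h.ker)) _ _ fun k => ?_
      simp [← mul_assoc]
    | zero =>
      simp only [Pi.zero_apply, Finset.sum_const_zero, mul_zero]
      exact zero_mem _
    | add x y _ _ hx hy =>
      simp only [Pi.add_apply, Finset.sum_add_distrib, mul_add]
      exact add_mem hx hy
    | neg x _ hx =>
      simp only [Pi.neg_apply, Finset.sum_neg_distrib, mul_neg]
      exact neg_mem hx
  have h1 := key _ hf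
  have hk0 : (Nat.card h.ker : ℂ) ≠ 0 := by exact_mod_cast Nat.card_pos.ne'
  have hk1 : ∀ k : h.ker, h k = 1 := fun k => k.2
  convert h1 using 2 with x
  simp only [map_mul, hu, hk1, mul_one, Finset.sum_const, Finset.card_univ,
    ← Nat.card_eq_fintype_card, nsmul_eq_mul]
  rw [inv_mul_cancel_left₀ hk0]

/-- A central extension `h : E →* Q` together with a linear character `l` of its kernel, and
exponents `j`, `k` such that `e ↦ e ^ j` and `e ↦ e ^ k` are the `π`-part and the `π'`-part, the
kernel being a `π`-group. -/
structure PiExtension (π : Set ℕ) {E Q : Type} [Group E] [Group Q] (h : E →* Q) (l : E → ℂ)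
    (j k : ℕ) : Prop where
  surjective : Function.Surjective h
  central : ∀ z ∈ h.ker, ∀ e, z * e = e * z
  map_mul : ∀ z ∈ h.ker, ∀ y ∈ h.ker, l (z * y) = l z * l y
  mul_conj : ∀ z ∈ h.ker, l z * conj (l z) = 1
  pow_mul_pow : ∀ e : E, e ^ k * e ^ j = e
  ker_pow : ∀ z ∈ h.ker, z ^ k = 1
  pow_pow : ∀ e : E, (e ^ k) ^ j = 1
  pow_mem : ∀ S : Subgroup Q, (∀ q : ℕ, q.Prime → q ∣ Nat.card S → q ∉ π) →
    ∀ x : Q, x ^ j ∈ S → x ^ j = 1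

/-- The irreducible characters of `E` over the linear character `l` of the kernel of `h : E →* Q`
whose degree has the same `π`-part as the order of `Q`. -/
def dzOver (π : Set ℕ) {E Q : Type} [Group E] [Group Q] (h : E →* Q) (l : E → ℂ) :
    Set (E → ℂ) :=
  {s | IsIrrChar E s ∧ (∀ e, ∀ z ∈ h.ker, s (e * z) = l z * s e) ∧
    ∃ d : ℕ, s 1 = d ∧ Nat.piPart π d = Nat.piPart π (Nat.card Q)}

namespace PiExtension

variable {π : Set ℕ} {E Q : Type} [Group E] [Group Q] {h : E →* Q} {l : E → ℂ} {j k : ℕ}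

theorem ker_pow_eq (H : PiExtension π h l j k) {z : E} (hz : z ∈ h.ker) : z ^ j = z := by
  simpa [H.ker_pow z hz] using H.pow_mul_pow z

theorem mul_pow (H : PiExtension π h l j k) (e : E) {z : E} (hz : z ∈ h.ker) (n : ℕ) :
    (e * z) ^ n = e ^ n * z ^ n :=
  (show Commute e z from (H.central z hz e).symm).mul_pow n

theorem map_one (H : PiExtension π h l j k) : l 1 = 1 := by
  have h1 := H.map_mul 1 (one_mem _) 1 (one_mem _)
  have h2 := H.mul_conj 1 (one_mem _)
  rw [mul_one] at h1
  have h3 : l 1 ≠ 0 := by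
    intro h0
    simp [h0] at h2
  exact (mul_eq_left₀ h3).1 h1.symm

theorem isIntegral [Finite E] (H : PiExtension π h l j k) {z : E} (hz : z ∈ h.ker) :
    IsIntegral ℤ (l z) := by
  have h1 : ∀ n : ℕ, l (z ^ n) = l z ^ n := fun n => by
    induction n with
    | zero => simpa using H.map_one
    | succ n ih => rw [pow_succ, H.map_mul _ (_root_.pow_mem hz n) z hz, ih, pow_succ]
  refine IsIntegral.of_pow (n := Nat.card E) Nat.card_pos ?_
  rw [← h1, pow_card_eq_one', H.map_one]
  exact isIntegral_one

theorem pow_mem_ker {e : E} (he : h e ^ j = 1) : e ^ j ∈ h.ker := by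
  rw [MonoidHom.mem_ker, _root_.map_pow, he]

theorem apply_eq (H : PiExtension π h l j k) {s : E → ℂ}
    (hs : ∀ e, ∀ z ∈ h.ker, s (e * z) = l z * s e) {e : E} (he : h e ^ j = 1) :
    s e = l (e ^ j) * s (e ^ k) := by
  conv_lhs => rw [← H.pow_mul_pow e]
  exact hs _ _ (pow_mem_ker he)

theorem apply_pow_eq (H : PiExtension π h l j k) {x : Q} (hx : x ^ j = 1) : x ^ k = x := by
  obtain ⟨e, rfl⟩ := H.surjective x
  rw [← _root_.map_pow] at hx
  conv_rhs => rw [← H.pow_mul_pow e, _root_.map_mul, hx, mul_one, _root_.map_pow]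

theorem exists_int [Finite E] [Finite Q] (H : PiExtension π h l j k) {s : E → ℂ}
    (hs : s ∈ dzOver π h l) {w : E → ℂ} (hw : ∀ e f, w (f * e * f⁻¹) = w e)
    (hwi : ∀ e, IsIntegral ℤ (w e)) (hwl : ∀ e, ∀ z ∈ h.ker, w (e * z) = l z * w e)
    (hS : ∀ S : Subgroup Q, (∀ q : ℕ, q.Prime → q ∣ Nat.card S → q ∉ π) →
      ∃ z : ℤ, S.index * charInner E s w = z) : ∃ z : ℤ, charInner E s w = z := by
  obtain ⟨h1, h2, d, hd, hdA⟩ := hs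
  have hI := h1.isIntegral_charInner H.surjective H.central H.mul_conj h2 hw hwi hwl
  have hQ : Nat.card Q ≠ 0 := Nat.card_pos.ne'
  have hd0 : d ≠ 0 := by
    rintro rfl
    exact h1.degree_ne_zero (by simpa using hd)
  refine exists_int_of_index_mul π (B := Nat.card Q / Nat.piPart π (Nat.card Q))
    (fun q hq => Nat.notMem_of_dvd_div_piPart π hQ hq) ?_ hS
  obtain ⟨D, hD⟩ := hdA ▸ Nat.piPart_dvd π hd0
  obtain ⟨B, hB⟩ := Nat.piPart_dvd π hQ
  have hA0 := Nat.piPart_ne_zero π (Nat.card Q)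
  set A := Nat.piPart π (Nat.card Q) with hA
  rw [Nat.div_eq_of_eq_mul_right (Nat.pos_of_ne_zero hA0) hB]
  have h3 : (B : ℂ) * charInner E s w = D * (Nat.card Q / s 1 * charInner E s w) := by
    have hD0 : (D : ℂ) ≠ 0 := by
      rintro h0
      rw [Nat.cast_eq_zero] at h0
      simp [h0] at hD
      exact hd0 hD
    have hA0' : (A : ℂ) ≠ 0 := by exact_mod_cast hA0
    rw [hd, hD, hB]
    push_cast
    field_simp
  rw [h3]
  exact (isIntegral_algebraMap (x := (D : ℤ))).mul hI

open Classical in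
theorem eq_zero [Finite E] [Finite Q] (H : PiExtension π h l j k) {s : E → ℂ}
    (hs : s ∈ dzOver π h l) {e : E} (he : h e ^ j ≠ 1) : s e = 0 := by
  cases nonempty_fintype E
  let w : E → ℂ := fun e => if h e ^ j = 1 then s e else 0
  have hw : ∀ e f, w (f * e * f⁻¹) = w e := fun e f => by
    have h1 : h (f * e * f⁻¹) ^ j = 1 ↔ h e ^ j = 1 := by
      rw [_root_.map_mul, _root_.map_mul, map_inv, conj_pow, conj_eq_one_iff]
    simp only [w, h1, hs.1.1.conj_apply]
  have hwi : ∀ e, IsIntegral ℤ (w e) := fun e => by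
    simp only [w]
    split_ifs
    · exact hs.1.1.isIntegral e
    · exact isIntegral_zero
  have hwl : ∀ e, ∀ z ∈ h.ker, w (e * z) = l z * w e := fun e z hz => by
    have h1 : h (e * z) = h e := by rw [_root_.map_mul, (show h z = 1 from hz), mul_one]
    simp only [w, h1, hs.2.1 e z hz, mul_ite, mul_zero]
  obtain ⟨c, hc⟩ := H.exists_int hs hw hwi hwl fun S hS => by
    have h1 := genChars_comp_mem (S.permutation_adams_mem j (H.pow_mem S hS)) h
    obtain ⟨z, hz⟩ := genChars_charInner_int
      (genChars_mul_mem h1 hs.1.1.mem_genChars) hs.1.1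
    refine ⟨z, hz ▸ ?_⟩
    rw [charInner_eq_sum, charInner_eq_sum, mul_left_comm, Finset.mul_sum]
    congr 1
    refine Finset.sum_congr rfl fun e _ => ?_
    simp only [w, Pi.mul_apply]
    split_ifs <;> simp [mul_assoc]
  have h1 : charInner E w w = c := by
    rw [← hc, charInner_eq_sum, charInner_eq_sum]
    congr 1
    refine Finset.sum_congr rfl fun e _ => ?_
    simp only [w]
    split_ifs <;> simp
  have h2 : charInner E (s - w) (s - w) = ((1 - c : ℝ) : ℂ) := by
    rw [charInner_sub_left, charInner_sub_right, charInner_sub_right, hs.1.2, hc,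
      ← charInner_conj_symm, hc, h1]
    simp
  have h3 : s - w = 0 := by
    refine eq_zero_of_charInner_self_nonpos h2 ?_
    by_contra hlt
    have h4 : w = 0 := eq_zero_of_charInner_self_nonpos (r := c) (by simpa using h1) (by
      have : (c : ℝ) < 1 := by linarith
      have h5 : c < 1 := by exact_mod_cast this
      exact_mod_cast Int.lt_add_one_iff.1 h5)
    have h5 := congrFun h4 1
    simp only [w, _root_.map_one, one_pow, if_true] at h5
    exact hs.1.degree_ne_zero h5
  have h4 := congrFun h3 e
  simpa [w, he] using h4

end PiExtension

theorem IsIrrChar.apply_mul_of_charInner_ne_zero {E Q : Type} [Group E] [Finite E] [Group Q]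
    {h : E →* Q} (hker : ∀ z ∈ h.ker, ∀ e, z * e = e * z) {l : E → ℂ}
    (hl : ∀ z ∈ h.ker, l z * conj (l z) = 1) {f s : E → ℂ} (hs : IsIrrChar E s)
    (hf : ∀ e, ∀ z ∈ h.ker, f (e * z) = l z * f e) (hfs : charInner E f s ≠ 0) (e : E)
    {z : E} (hz : z ∈ h.ker) : s (e * z) = l z * s e := by
  cases nonempty_fintype E
  obtain ⟨V, _, _, _, ρ, rfl⟩ := hs.1.exists_rep
  obtain ⟨c, hc⟩ := IsIrrChar.exists_central hs.2 (hker z hz)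
  have h1 : ∀ e, ρ.character (e * z) = c * ρ.character e := fun e => by
    simp only [Representation.character, map_mul, hc]
    rw [mul_smul_comm, map_smul]
    rfl
  have h2 : charInner E f ρ.character = l z * conj c * charInner E f ρ.character := by
    conv_lhs => rw [charInner_eq_sum, ← Equiv.sum_comp (Equiv.mulRight z)]
    rw [charInner_eq_sum, mul_left_comm (l z * conj c)]
    congr 1
    rw [Finset.mul_sum]
    refine Finset.sum_congr rfl fun e _ => ?_
    rw [Equiv.coe_mulRight, h1, hf e z hz, map_mul]
    ring
  have h3 : l z * conj c = 1 := mul_right_cancel₀ hfs (by rw [one_mul]; exact h2.symm)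
  have h4 : conj (l z) ≠ 0 := right_ne_zero_of_mul_eq_one (hl z hz)
  have h5 : conj (l z) * c = 1 := by
    have := congrArg conj h3
    simpa using this
  have h6 : c = l z := mul_left_cancel₀ h4 (by rw [h5, mul_comm, hl z hz])
  rw [h1, h6]

section transfer

variable {E Q : Type} [Group E] [Group Q]

open Classical in
/-- The class function of `E` over `l` which has the values of `χ`
on the parts of order prime to `π`. -/
def liftTwist (h : E →* Q) (l : E → ℂ) (j : ℕ) (χ : Q → ℂ) (e : E) : ℂ :=
  if h e ^ j = 1 then l (e ^ j) * χ (h e) else 0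

open Classical in
/-- The class function of `Q` which has the values of `s` on the parts of order prime to `π`. -/
def descendTwist (h : E →* Q) (j k : ℕ) (s : E → ℂ) (x : Q) : ℂ :=
  if x ^ j = 1 then s (Function.invFun h x ^ k) else 0

namespace PiExtension

variable {π : Set ℕ} {h : E →* Q} {l : E → ℂ} {j k : ℕ}

open Classical in
theorem descendTwist_comp (H : PiExtension π h l j k) (s : E → ℂ) (e : E) :
    descendTwist h j k s (h e) = if h e ^ j = 1 then s (e ^ k) else 0 := by
  have h1 : e⁻¹ * Function.invFun h (h e) ∈ h.ker := by
    rw [MonoidHom.mem_ker, _root_.map_mul, Function.rightInverse_invFun H.surjective, map_inv,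
      inv_mul_cancel]
  have h2 : Function.invFun h (h e) ^ k = e ^ k := by
    rw [← mul_inv_cancel_left e (Function.invFun h (h e)), H.mul_pow _ h1, H.ker_pow _ h1, mul_one]
  rw [descendTwist, h2]

theorem refl [Finite E] [Finite Q] (H : PiExtension π h l j k) :
    PiExtension π (MonoidHom.id Q) 1 j k where
  surjective := Function.surjective_id
  central := by rintro z rfl e; simp
  map_mul := by simp
  mul_conj := by simp
  pow_mul_pow x := by
    obtain ⟨e, rfl⟩ := H.surjective x
    rw [← _root_.map_pow, ← _root_.map_pow, ← _root_.map_mul, H.pow_mul_pow]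
  ker_pow := by rintro z rfl; simp
  pow_pow x := by
    obtain ⟨e, rfl⟩ := H.surjective x
    rw [← _root_.map_pow, ← _root_.map_pow, H.pow_pow, _root_.map_one]
  pow_mem S hS x hx := H.pow_mem S hS x hx

theorem eq_zero_of_mem_dzSet [Finite E] [Finite Q] (H : PiExtension π h l j k) {χ : Q → ℂ}
    (hχ : χ ∈ dzSet π Q) {x : Q} (hx : x ^ j ≠ 1) : χ x = 0 := by
  refine H.refl.eq_zero ⟨hχ.1, ?_, hχ.2⟩ hx
  rintro e z rfl
  simp

theorem norm_map (H : PiExtension π h l j k) {e : E} (he : h e ^ j = 1) :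
    l (e ^ j) * conj (l (e ^ j)) = 1 :=
  H.mul_conj _ (pow_mem_ker he)

theorem liftTwist_mul (H : PiExtension π h l j k) (χ : Q → ℂ) (e : E) {z : E} (hz : z ∈ h.ker) :
    liftTwist h l j χ (e * z) = l z * liftTwist h l j χ e := by
  have h1 : h (e * z) = h e := by rw [_root_.map_mul, (show h z = 1 from hz), mul_one]
  rw [liftTwist, liftTwist, h1]
  split_ifs with he
  · rw [H.mul_pow e hz, H.ker_pow_eq hz, H.map_mul _ (pow_mem_ker he) z hz]
    ring
  · rw [mul_zero]

theorem liftTwist_conj (H : PiExtension π h l j k) {χ : Q → ℂ} (hχ : IsChar Q χ) (e f : E) :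
    liftTwist h l j χ (f * e * f⁻¹) = liftTwist h l j χ e := by
  have h1 : h (f * e * f⁻¹) = h f * h e * (h f)⁻¹ := by simp
  have h2 : h (f * e * f⁻¹) ^ j = 1 ↔ h e ^ j = 1 := by
    rw [h1, conj_pow, conj_eq_one_iff]
  by_cases he : h e ^ j = 1
  · rw [liftTwist, liftTwist, if_pos he, if_pos (h2.2 he), h1, hχ.conj_apply, conj_pow,
      ← H.central _ (pow_mem_ker he), mul_inv_cancel_right]
  · rw [liftTwist, liftTwist, if_neg he, if_neg (mt h2.1 he)]

theorem liftTwist_isIntegral [Finite E] [Finite Q] (H : PiExtension π h l j k) {χ : Q → ℂ}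
    (hχ : IsChar Q χ) (e : E) : IsIntegral ℤ (liftTwist h l j χ e) := by
  rw [liftTwist]
  split_ifs with he
  · exact (H.isIntegral (pow_mem_ker he)).mul (hχ.isIntegral _)
  · exact isIntegral_zero

theorem liftTwist_one (H : PiExtension π h l j k) (χ : Q → ℂ) : liftTwist h l j χ 1 = χ 1 := by
  simp [liftTwist, H.map_one]

theorem descendTwist_one (H : PiExtension π h l j k) (s : E → ℂ) :
    descendTwist h j k s 1 = s 1 := by
  have := H.descendTwist_comp s 1
  simpa using this

theorem liftTwist_mem [Finite E] [Finite Q] (H : PiExtension π h l j k) {s₀ : E → ℂ}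
    (hs₀ : IsChar E s₀) (hs₀1 : s₀ 1 ≠ 0) (hs₀l : ∀ e, ∀ z ∈ h.ker, s₀ (e * z) = l z * s₀ e)
    {χ : Q → ℂ} (hχ : χ ∈ dzSet π Q) : liftTwist h l j χ ∈ dzOver π h l := by
  cases nonempty_fintype E
  obtain ⟨d, hd, hd'⟩ := hχ.2
  refine ⟨?_, fun e z hz => H.liftTwist_mul χ e hz, d, by rw [H.liftTwist_one, hd], hd'⟩
  have hχh : (fun e => χ (h e)) ∈ genChars E := (hχ.1.1.comp h).mem_genChars
  refine isIrrChar_of_genChars hs₀1 ?_ ?_ ?_ ⟨d, by rw [H.liftTwist_one, hd]⟩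
  · convert genChars_mul_mem (genChars_adams_mem hs₀.mem_genChars j) hχh using 1
    funext e
    simp only [Pi.smul_apply, Pi.mul_apply, smul_eq_mul, liftTwist]
    split_ifs with he
    · have := hs₀l 1 _ (pow_mem_ker he)
      rw [one_mul] at this
      rw [this]
      ring
    · rw [H.eq_zero_of_mem_dzSet hχ he, mul_zero, mul_zero]
  · rw [← hχ.1.2, ← charInner_comp H.surjective, charInner_eq_sum, charInner_eq_sum]
    congr 1
    refine Finset.sum_congr rfl fun e _ => ?_
    rw [liftTwist]
    split_ifs with he
    · rw [_root_.map_mul, mul_mul_mul_comm, H.norm_map he, one_mul]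
    · simp [H.eq_zero_of_mem_dzSet hχ he]
  · intro s hs hne
    have hsl : ∀ e, ∀ z ∈ h.ker, s (e * z) = l z * s e := fun e z hz =>
      hs.apply_mul_of_charInner_ne_zero H.central H.mul_conj
        (fun e z hz => H.liftTwist_mul χ e hz) hne e hz
    obtain ⟨z, hz⟩ := genChars_charInner_int (genChars_adams_mem hs.1.mem_genChars k)
      (hχ.1.1.comp h)
    refine ⟨z, ?_⟩
    have h1 : charInner E (fun e => χ (h e)) (fun e => s (e ^ k)) = z := by
      rw [← charInner_conj_symm, hz, map_intCast]
    rw [← h1, charInner_eq_sum, charInner_eq_sum]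
    congr 1
    refine Finset.sum_congr rfl fun e _ => ?_
    rw [liftTwist]
    split_ifs with he
    · rw [H.apply_eq hsl he, _root_.map_mul, mul_mul_mul_comm, H.norm_map he, one_mul]
    · simp [H.eq_zero_of_mem_dzSet hχ he]

theorem descendTwist_mem [Finite E] [Finite Q] (H : PiExtension π h l j k)
    {s : E → ℂ} (hs : s ∈ dzOver π h l) : descendTwist h j k s ∈ dzSet π Q := by
  cases nonempty_fintype E
  obtain ⟨d, hd, hd'⟩ := hs.2.2
  refine ⟨?_, d, by rw [H.descendTwist_one, hd], hd'⟩
  have hτ := fun (S : Subgroup Q) hS =>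
    genChars_mul_mem (genChars_comp_mem (S.permutation_adams_mem j (H.pow_mem S hS)) h)
      (genChars_adams_mem hs.1.1.mem_genChars k)
  refine isIrrChar_of_genChars (c := ((⊥ : Subgroup Q).index : ℂ)) ?_ ?_ ?_ ?_
    ⟨d, by rw [H.descendTwist_one, hd]⟩
  · rw [Subgroup.index_bot]
    exact_mod_cast Nat.card_pos.ne'
  · refine genChars_descend H.surjective ?_
    convert hτ ⊥ (by simp +contextual [Nat.Prime.ne_one]) using 1
    funext e
    simp only [Pi.smul_apply, Pi.mul_apply, H.descendTwist_comp, smul_eq_mul]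
    split_ifs <;> simp
  · rw [← hs.1.2, ← charInner_comp H.surjective, charInner_eq_sum, charInner_eq_sum]
    congr 1
    refine Finset.sum_congr rfl fun e _ => ?_
    rw [H.descendTwist_comp]
    split_ifs with he
    · rw [H.apply_eq hs.2.1 he, _root_.map_mul, mul_mul_mul_comm, H.norm_map he, one_mul]
    · simp [H.eq_zero hs he]
  · intro β hβ _
    have hc : charInner Q (descendTwist h j k s) β = charInner E s (liftTwist h l j β) := by
      rw [← charInner_comp H.surjective, charInner_eq_sum, charInner_eq_sum]
      congr 1
      refine Finset.sum_congr rfl fun e _ => ?_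
      rw [H.descendTwist_comp, liftTwist]
      split_ifs with he
      · rw [H.apply_eq hs.2.1 he, _root_.map_mul, mul_mul_mul_comm, H.norm_map he, one_mul]
      · simp
    rw [hc]
    refine H.exists_int hs (H.liftTwist_conj hβ.1) (H.liftTwist_isIntegral hβ.1)
      (fun e z hz => H.liftTwist_mul β e hz) fun S hS => ?_
    obtain ⟨z, hz⟩ := genChars_charInner_int (hτ S hS) (hβ.1.comp h)
    refine ⟨z, ?_⟩
    rw [← hz, ← hc, ← charInner_comp H.surjective, charInner_eq_sum, charInner_eq_sum,
      mul_left_comm, Finset.mul_sum]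
    congr 1
    refine Finset.sum_congr rfl fun e _ => ?_
    simp only [H.descendTwist_comp, Pi.mul_apply]
    split_ifs <;> simp [mul_assoc]

theorem card_dzSet_eq_card_dzOver [Finite E] [Finite Q] (H : PiExtension π h l j k) {s₀ : E → ℂ}
    (hs₀ : IsChar E s₀) (hs₀1 : s₀ 1 ≠ 0) (hs₀l : ∀ e, ∀ z ∈ h.ker, s₀ (e * z) = l z * s₀ e) :
    Nat.card (dzSet π Q) = Nat.card (dzOver π h l) := by
  refine Nat.card_congr
    { toFun := fun χ => ⟨liftTwist h l j χ, H.liftTwist_mem hs₀ hs₀1 hs₀l χ.2⟩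
      invFun := fun s => ⟨descendTwist h j k s, H.descendTwist_mem s.2⟩
      left_inv := fun ⟨χ, hχ⟩ => Subtype.ext (funext fun x => ?_)
      right_inv := fun ⟨s, hs⟩ => Subtype.ext (funext fun e => ?_) }
  · obtain ⟨e, rfl⟩ := H.surjective x
    change descendTwist h j k (liftTwist h l j χ) (h e) = χ (h e)
    rw [H.descendTwist_comp]
    split_ifs with he
    · rw [liftTwist, _root_.map_pow, H.apply_pow_eq he, if_pos he, H.pow_pow, H.map_one, one_mul]
    · exact (H.eq_zero_of_mem_dzSet hχ he).symm
  · change liftTwist h l j (descendTwist h j k s) e = s e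
    rw [liftTwist, H.descendTwist_comp]
    split_ifs with he
    · exact (H.apply_eq hs.2.1 he).symm
    · exact (H.eq_zero hs he).symm

end PiExtension

end transfer

theorem exists_piExtension {π : Set ℕ} {E Q : Type} [Group E] [Group Q] [Finite E] [Finite Q]
    {h : E →* Q} (hh : Function.Surjective h) (hc : ∀ z ∈ h.ker, ∀ e, z * e = e * z) {m : ℕ}
    (hm : IsPiNumber π m) (hz : ∀ z ∈ h.ker, z ^ m = 1) {s₀ : E → ℂ} {l : E → ℂ}
    (hs₀ : IsChar E s₀) (hs₀1 : s₀ 1 ≠ 0) (hs₀l : ∀ e, ∀ z ∈ h.ker, s₀ (e * z) = l z * s₀ e) :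
    ∃ j k : ℕ, PiExtension π h l j k := by
  set n := Nat.card E with hn
  have hn0 : n ≠ 0 := Nat.card_pos.ne'
  set a := Nat.piPart π n with ha
  set b := n / a with hb
  have hab : a * b = n := Nat.mul_div_cancel' (Nat.piPart_dvd π hn0)
  have hco : ∀ u v : ℕ, (∀ q : ℕ, q.Prime → q ∣ u → q ∈ π) → (∀ q : ℕ, q.Prime → q ∣ v → q ∉ π) →
      u.Coprime v := fun u v hu hv =>
    Nat.Coprime.symm (Nat.coprime_of_dvd fun q hq hqv hqu => hv q hq hqv (hu q hq hqu))
  have haπ : ∀ q : ℕ, q.Prime → q ∣ a → q ∈ π := fun q hq hd => Nat.mem_of_dvd_piPart π hq hd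
  have hbπ : ∀ q : ℕ, q.Prime → q ∣ b → q ∉ π := fun q hq hd =>
    Nat.notMem_of_dvd_div_piPart π hn0 hq hd
  have habc := hco a b haπ hbπ
  obtain ⟨k, hka, hkb⟩ := Nat.chineseRemainder habc 0 1
  obtain ⟨j, hja, hjb⟩ := Nat.chineseRemainder habc 1 0
  have hak : a ∣ k := (Nat.modEq_zero_iff_dvd).1 hka
  have hbj : b ∣ j := (Nat.modEq_zero_iff_dvd).1 hjb
  have hkj : k + j ≡ 1 [MOD n] := by
    rw [← hab, ← Nat.modEq_and_modEq_iff_modEq_mul habc]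
    exact ⟨hka.add hja, hkb.add hjb⟩
  have hl1 : ∀ z ∈ h.ker, s₀ z = l z * s₀ 1 := fun z hz => by simpa using hs₀l 1 z hz
  have hmul : ∀ z ∈ h.ker, ∀ y ∈ h.ker, l (z * y) = l z * l y := fun z hz y hy => by
    refine mul_right_cancel₀ hs₀1 ?_
    rw [← hl1 _ (mul_mem hz hy), hs₀l _ _ hy, hl1 z hz]
    ring
  refine ⟨j, k, hh, hc, hmul, fun z hz => ?_, fun e => ?_, fun z hz' => ?_, fun e => ?_,
    fun S hS x hx => ?_⟩
  · have h1 : l 1 = 1 := mul_right_cancel₀ hs₀1 (by rw [← hl1 1 (one_mem _), one_mul])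
    have h2 : l z⁻¹ = conj (l z) := by
      refine mul_right_cancel₀ hs₀1 ?_
      obtain ⟨d, hd⟩ := hs₀.exists_degree
      rw [← hl1 _ (inv_mem hz), hs₀.inv_apply, hl1 z hz, map_mul, hd, map_natCast]
    rw [← h2, ← hmul z hz _ (inv_mem hz), mul_inv_cancel, h1]
  · rw [← pow_add]
    conv_rhs => rw [← pow_one e]
    exact pow_eq_pow_iff_modEq.2 (hkj.of_dvd (orderOf_dvd_natCard e))
  · refine orderOf_dvd_iff_pow_eq_one.1 (dvd_trans ?_ hak)
    have h1 : orderOf z ∣ a * b := hab ▸ orderOf_dvd_natCard z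
    refine (hco _ b (fun q hq hd => hm q hq ?_) hbπ).dvd_of_dvd_mul_right h1
    exact hd.trans (orderOf_dvd_of_pow_eq_one (hz z hz'))
  · rw [← pow_mul]
    refine orderOf_dvd_iff_pow_eq_one.1 ((orderOf_dvd_natCard e).trans ?_)
    rw [← hn, ← hab]
    exact mul_dvd_mul hak hbj
  · have h1 : orderOf (x ^ j) ∣ a := by
      refine orderOf_dvd_of_pow_eq_one ?_
      rw [← pow_mul]
      obtain ⟨e, rfl⟩ := hh x
      rw [← map_pow, orderOf_dvd_iff_pow_eq_one.1 ((orderOf_dvd_natCard e).trans ?_), map_one]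
      rw [← hn, ← hab, mul_comm]
      exact mul_dvd_mul hbj dvd_rfl
    have h2 : orderOf (x ^ j) ∣ Nat.card S := by
      have := orderOf_dvd_natCard (⟨x ^ j, hx⟩ : S)
      rwa [← Subgroup.orderOf_coe] at this
    rw [← orderOf_eq_one_iff]
    exact Nat.eq_one_of_dvd_coprimes (hco a (Nat.card S) haπ hS) h1 h2

theorem IsChar.eq_one_of_degree_one {G : Type} [Group G] [Finite G] {χ : G → ℂ}
    (h : IsChar G χ) (h1 : χ 1 = 1) {g : G} {r : ℝ} (hr : 0 ≤ r) (hg : χ g = r) : χ g = 1 := by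
  obtain ⟨d, A, hA⟩ := h.exists_matrix
  have hd : d = 1 := by
    rw [hA, _root_.map_one, Matrix.trace_one, Fintype.card_fin] at h1
    exact_mod_cast h1
  subst hd
  have hmul : ∀ x y, χ (x * y) = χ x * χ y := fun x y => by
    simp [hA, Matrix.trace, Matrix.mul_apply]
  have h2 := hmul g g⁻¹
  rw [mul_inv_cancel, h1, h.inv_apply, hg, Complex.conj_ofReal] at h2
  have h3 : r * r = 1 := by exact_mod_cast h2.symm
  have h4 : r = 1 := by nlinarith
  rw [hg, h4, Complex.ofReal_one]

theorem Subgroup.exists_charInner_ne_zero {G : Type} [Group G] [Finite G] (N : Subgroup G)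
    {θ : N → ℂ} (hθ1 : θ 1 ≠ 0) :
    ∃ ψ, IsChar G ψ ∧ charInner N (fun n => ψ n) θ ≠ 0 := by
  cases nonempty_fintype N
  refine ⟨_, (⊥ : Subgroup G).isChar_permutation, ?_⟩
  rw [charInner_eq_sum, Fintype.sum_eq_single 1]
  · refine mul_ne_zero (by simp) (mul_ne_zero ?_ ?_)
    · have : Nonempty {c : G ⧸ (⊥ : Subgroup G) // c = ((1 : N) : G) • c} := ⟨⟨1, by simp⟩⟩
      exact_mod_cast Nat.card_pos.ne'
    · simpa using hθ1
  · intro n hn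
    have : IsEmpty {c : G ⧸ (⊥ : Subgroup G) // c = (n : G) • c} := by
      refine ⟨fun ⟨c, hc⟩ => hn ?_⟩
      induction c using QuotientGroup.induction_on with
      | H q =>
        have h1 : q⁻¹ * ((n : G) * q) ∈ (⊥ : Subgroup G) := QuotientGroup.eq.1 hc
        rw [Subgroup.mem_bot, inv_mul_eq_one, eq_comm, mul_eq_right] at h1
        exact Subtype.ext h1
    simp

/-- A common central extension `p : Γ →* G` on which the character `θ` of `N` extends to a
character `X`: the copy of `N` in `Γ` is the kernel of `f : Γ →* E`, and `E` is a central
extension of `G ⧸ N`. -/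
structure ExtendedTriple {Γ E G : Type} [Group Γ] [Group E] [Group G] (N : Subgroup G) [N.Normal]
    (θ : N → ℂ) (f : Γ →* E) (p : Γ →* G) (h : E →* G ⧸ N) (X : Γ → ℂ) : Prop where
  f_surjective : Function.Surjective f
  p_surjective : Function.Surjective p
  comm : ∀ γ, h (f γ) = (p γ : G ⧸ N)
  exists_of_mem_ker : ∀ e ∈ h.ker, ∃ z ∈ p.ker, f z = e
  exists_of_mem : ∀ n ∈ N, ∃ x ∈ f.ker, p x = n
  eq_one : ∀ x ∈ f.ker, p x = 1 → x = 1
  central : ∀ z ∈ p.ker, ∀ γ, z * γ = γ * z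
  isChar : IsChar Γ X
  scalar : ∀ z ∈ p.ker, ∃ w : ℂ, w * conj w = 1 ∧ ∀ γ, X (γ * z) = w * X γ
  extends_theta : ∀ x ∈ f.ker, ∀ hx : p x ∈ N, X x = θ ⟨p x, hx⟩

section gallagher

variable {Γ E G : Type} [Group Γ] [Group E] [Group G]

/-- The multiplicity character of `ψ` relative to `X`. -/
def multiplicityChar (f : Γ →* E) (p : Γ →* G) (X : Γ → ℂ) (ψ : G → ℂ) (e : E) : ℂ :=
  (Nat.card f.ker : ℂ)⁻¹ * ∑ᶠ x : f.ker,
    ψ (p (Function.invFun f e * x)) * conj (X (Function.invFun f e * x))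

namespace ExtendedTriple

variable {N : Subgroup G} [N.Normal] {θ : N → ℂ} {f : Γ →* E} {p : Γ →* G} {h : E →* G ⧸ N}
  {X : Γ → ℂ}

theorem multiplicity_apply (H : ExtendedTriple N θ f p h X) [Fintype f.ker] (ψ : G → ℂ) (γ : Γ) :
    multiplicityChar f p X ψ (f γ) =
      (Nat.card f.ker : ℂ)⁻¹ * ∑ x : f.ker, ψ (p (γ * x)) * conj (X (γ * x)) := by
  rw [multiplicityChar, finsum_eq_sum_of_fintype]
  congr 1
  have hk : γ⁻¹ * Function.invFun f (f γ) ∈ f.ker := by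
    rw [MonoidHom.mem_ker, map_mul, Function.rightInverse_invFun H.f_surjective, map_inv,
      inv_mul_cancel]
  refine Fintype.sum_equiv (Equiv.mulLeft (⟨_, hk⟩ : f.ker)) _ _ fun k => ?_
  simp only [Equiv.coe_mulLeft, Subgroup.coe_mul, ← mul_assoc, mul_inv_cancel, one_mul]

theorem mem_of_mem_ker (H : ExtendedTriple N θ f p h X) {x : Γ} (hx : x ∈ f.ker) : p x ∈ N := by
  rw [← QuotientGroup.eq_one_iff, ← H.comm, (show f x = 1 from hx), map_one]

/-- The kernel of `f` is a copy of `N`. -/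
def kerEquiv (H : ExtendedTriple N θ f p h X) : f.ker ≃ N :=
  Equiv.ofBijective (fun x => ⟨p x, H.mem_of_mem_ker x.2⟩) (by
    constructor
    · intro x y hxy
      have h1 : p x = p y := congrArg Subtype.val hxy
      have h2 : (x : Γ)⁻¹ * y = 1 := H.eq_one _ (mul_mem (inv_mem x.2) y.2) (by simp [h1])
      exact Subtype.ext (inv_mul_eq_one.1 h2)
    · rintro ⟨n, hn⟩
      obtain ⟨x, hx, rfl⟩ := H.exists_of_mem n hn
      exact ⟨⟨x, hx⟩, rfl⟩)

theorem charInner_ker [Finite Γ] (H : ExtendedTriple N θ f p h X) (φ : N → ℂ) :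
    (Nat.card f.ker : ℂ)⁻¹ * ∑ᶠ x : f.ker, φ (H.kerEquiv x) * conj (X x) = charInner N φ θ := by
  rw [charInner, Nat.card_congr H.kerEquiv, finsum_eq_of_bijective H.kerEquiv H.kerEquiv.bijective]
  intro x
  rw [H.extends_theta x x.2 (H.mem_of_mem_ker x.2)]
  rfl

theorem multiplicity_one [Finite Γ] (H : ExtendedTriple N θ f p h X) (ψ : G → ℂ) :
    multiplicityChar f p X ψ 1 = charInner N (fun n => ψ n) θ := by
  have := Fintype.ofFinite f.ker
  rw [← H.charInner_ker, ← map_one f, H.multiplicity_apply, finsum_eq_sum_of_fintype]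
  simp only [one_mul]
  rfl

theorem isChar_multiplicity [Finite Γ] (H : ExtendedTriple N θ f p h X) {ψ : G → ℂ}
    (hψ : IsChar G ψ) : IsChar E (multiplicityChar f p X ψ) := by
  cases nonempty_fintype Γ
  have := Fintype.ofFinite f.ker
  exact IsChar.average H.f_surjective ((hψ.comp p).mul H.isChar.conj) fun γ =>
    H.multiplicity_apply ψ γ

theorem average_norm [Finite Γ] [Finite E] [Fintype f.ker]
    (H : ExtendedTriple N θ f p h X) (hθ : charInner N θ θ = 1) (γ : Γ) :
    (Nat.card f.ker : ℂ)⁻¹ * ∑ x : f.ker, X (γ * x) * conj (X (γ * x)) = 1 := by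
  cases nonempty_fintype Γ
  let F : Γ → ℂ := fun γ => (Nat.card f.ker : ℂ)⁻¹ * ∑ x : f.ker, X (γ * x) * conj (X (γ * x))
  have hF : ∀ γ, F (Function.invFun f (f γ)) = F γ := fun γ => by
    simp only [F]
    congr 1
    have hk : γ⁻¹ * Function.invFun f (f γ) ∈ f.ker := by
      rw [MonoidHom.mem_ker, map_mul, Function.rightInverse_invFun H.f_surjective, map_inv,
        inv_mul_cancel]
    refine Fintype.sum_equiv (Equiv.mulLeft (⟨_, hk⟩ : f.ker)) _ _ fun k => ?_
    simp only [Equiv.coe_mulLeft, Subgroup.coe_mul, ← mul_assoc, mul_inv_cancel, one_mul]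
  have h1 : IsChar E fun e => F (Function.invFun f e) :=
    IsChar.average H.f_surjective (H.isChar.mul H.isChar.conj) hF
  have hF1 : F 1 = 1 := by
    rw [← hθ, ← H.charInner_ker, finsum_eq_sum_of_fintype]
    simp only [F, one_mul]
    congr 1
    refine Finset.sum_congr rfl fun x _ => ?_
    conv_lhs => rw [H.extends_theta x x.2 (H.mem_of_mem_ker x.2)]
    conv_rhs => rw [H.extends_theta x x.2 (H.mem_of_mem_ker x.2)]
    rfl
  have h2 := h1.eq_one_of_degree_one (g := f γ)
    (r := (Nat.card f.ker : ℝ)⁻¹ * ∑ x : f.ker, ‖X (γ * x)‖ ^ 2)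
    (by rw [← map_one f, hF, hF1]) (by positivity) (by
      rw [hF]
      simp [F, Complex.mul_conj'])
  rwa [hF] at h2

theorem sum_mul_comp [Fintype Γ] [Fintype f.ker] (A : Γ → ℂ) (B : E → ℂ) :
    ∑ γ, A γ * B (f γ) = ∑ γ, ((Nat.card f.ker : ℂ)⁻¹ * ∑ x : f.ker, A (γ * x)) * B (f γ) := by
  have h0 : (Nat.card f.ker : ℂ) ≠ 0 := by exact_mod_cast Nat.card_pos.ne'
  have h1 : ∀ x : f.ker, ∑ γ, A (γ * x) * B (f γ) = ∑ γ, A γ * B (f γ) := fun x => by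
    refine Fintype.sum_equiv (Equiv.mulRight (x : Γ)) _ _ fun γ => ?_
    rw [Equiv.coe_mulRight, map_mul, (show f x = 1 from x.2), mul_one]
  simp only [mul_assoc, Finset.sum_mul, ← Finset.mul_sum]
  rw [Finset.sum_comm]
  simp only [h1, Finset.sum_const, Finset.card_univ, ← Nat.card_eq_fintype_card, nsmul_eq_mul]
  rw [inv_mul_cancel_left₀ h0]

theorem charInner_mul [Finite Γ] [Finite E] (H : ExtendedTriple N θ f p h X)
    (hθ : charInner N θ θ = 1) (s : E → ℂ) :
    charInner Γ (fun γ => X γ * s (f γ)) (fun γ => X γ * s (f γ)) = charInner E s s := by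
  cases nonempty_fintype Γ
  have := Fintype.ofFinite f.ker
  rw [← charInner_comp H.f_surjective, charInner_eq_sum, charInner_eq_sum]
  congr 1
  have h1 := sum_mul_comp (f := f) (fun γ => X γ * conj (X γ)) (fun e => s e * conj (s e))
  simp only [H.average_norm hθ, one_mul] at h1
  rw [← h1]
  refine Finset.sum_congr rfl fun γ _ => ?_
  rw [map_mul]
  ring

/-- Gallagher: an irreducible character over `θ` is the product of `X` and an irreducible
character. -/
theorem isIrrChar_multiplicity [Finite Γ] [Finite E] [Finite G] (H : ExtendedTriple N θ f p h X)
    (hθ : charInner N θ θ = 1) {ψ : G → ℂ} (hψ : IsIrrChar G ψ)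
    (hψθ : charInner N (fun n => ψ n) θ ≠ 0) :
    IsIrrChar E (multiplicityChar f p X ψ) ∧ ∀ γ, ψ (p γ) = X γ * multiplicityChar f p X ψ (f γ) := by
  cases nonempty_fintype Γ
  have := Fintype.ofFinite f.ker
  have hs := H.isChar_multiplicity hψ.1
  have hs1 := H.multiplicity_one ψ
  have hsm := H.multiplicity_apply ψ
  set s := multiplicityChar f p X ψ with hsdef
  obtain ⟨n, hn⟩ := hs.charInner_nat hs
  have hn0 : n ≠ 0 := by
    rintro rfl
    have h1 := eq_zero_of_charInner_self_nonpos (r := 0) (by simpa using hn) le_rfl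
    rw [h1, Pi.zero_apply] at hs1
    exact hψθ hs1.symm
  have hcross : charInner Γ (fun γ => ψ (p γ)) (fun γ => X γ * s (f γ)) = n := by
    rw [← hn, ← charInner_comp H.f_surjective, charInner_eq_sum, charInner_eq_sum]
    congr 1
    have h1 := sum_mul_comp (f := f) (fun γ => ψ (p γ) * conj (X γ)) (fun e => conj (s e))
    simp only [← hsm] at h1
    rw [← h1]
    refine Finset.sum_congr rfl fun γ _ => ?_
    rw [map_mul]
    ring
  have hnorm : charInner Γ ((fun γ => ψ (p γ)) - fun γ => X γ * s (f γ))
      ((fun γ => ψ (p γ)) - fun γ => X γ * s (f γ)) = ((1 - n : ℝ) : ℂ) := by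
    rw [charInner_sub_left, charInner_sub_right, charInner_sub_right, H.charInner_mul hθ, hn,
      ← charInner_conj_symm (fun γ => ψ (p γ)) (fun γ => X γ * s (f γ)), hcross, charInner_comp H.p_surjective, hψ.2]
    simp
  have hzero := eq_zero_of_charInner_self_nonpos hnorm (by
    have : (1 : ℝ) ≤ n := by exact_mod_cast Nat.one_le_iff_ne_zero.2 hn0
    linarith)
  have heq : (fun γ => ψ (p γ)) = fun γ => X γ * s (f γ) := sub_eq_zero.1 hzero
  refine ⟨⟨hs, ?_⟩, congrFun heq⟩
  rw [← H.charInner_mul hθ, ← heq, charInner_comp H.p_surjective, hψ.2]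

theorem multiplicity_mul [Finite Γ] (H : ExtendedTriple N θ f p h X) (ψ : G → ℂ) {z : Γ}
    (hz : z ∈ p.ker) {w : ℂ} (hw : ∀ γ, X (γ * z) = w * X γ) (e : E) :
    multiplicityChar f p X ψ (e * f z) = conj w * multiplicityChar f p X ψ e := by
  have := Fintype.ofFinite f.ker
  obtain ⟨γ, rfl⟩ := H.f_surjective e
  rw [← map_mul, H.multiplicity_apply, H.multiplicity_apply, mul_left_comm (conj w)]
  congr 1
  rw [Finset.mul_sum]
  refine Finset.sum_congr rfl fun x _ => ?_
  rw [mul_assoc, H.central z hz, ← mul_assoc, hw, map_mul p, (show p z = 1 from hz), mul_one,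
    map_mul conj]
  ring

theorem card_rdzSet [Finite Γ] [Finite E] [Finite G] (H : ExtendedTriple N θ f p h X)
    (hθ : IsIrrChar N θ) (π : Set ℕ) {l : E → ℂ}
    (hl : ∀ z ∈ p.ker, ∀ γ, l (f z) * X (γ * z) = X γ)
    (hl' : ∀ z ∈ p.ker, ∀ (ψ : G → ℂ) (e : E),
      multiplicityChar f p X ψ (e * f z) = l (f z) * multiplicityChar f p X ψ e) :
    Nat.card (rdzSet π G N θ) = Nat.card (dzOver π h l) := by
  have hX1 : X 1 = θ 1 := by
    rw [H.extends_theta 1 (one_mem _) (H.mem_of_mem_ker (one_mem _))]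
    congr 1
    exact Subtype.ext (map_one p)
  have hcard : N.index = Nat.card (G ⧸ N) := N.index_eq_card
  let Ψ : (E → ℂ) → G → ℂ := fun s g => X (Function.invFun p g) * s (f (Function.invFun p g))
  have hΨ : ∀ s ∈ dzOver π h l, ∀ γ, Ψ s (p γ) = X γ * s (f γ) := fun s hs γ => by
    set γ' := Function.invFun p (p γ) with hγ'
    have hz : γ⁻¹ * γ' ∈ p.ker := by
      rw [MonoidHom.mem_ker, map_mul, hγ', Function.rightInverse_invFun H.p_surjective, map_inv,
        inv_mul_cancel]
    have hz' : f (γ⁻¹ * γ') ∈ h.ker := by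
      rw [MonoidHom.mem_ker, H.comm, (show p _ = 1 from hz), QuotientGroup.mk_one]
    change X γ' * s (f γ') = _
    rw [← mul_inv_cancel_left γ γ', map_mul f, hs.2.1 _ _ hz', ← hl _ hz γ]
    ring
  have hmult : ∀ s ∈ dzOver π h l, multiplicityChar f p X (Ψ s) = s := fun s hs => by
    have := Fintype.ofFinite f.ker
    funext e
    obtain ⟨γ, rfl⟩ := H.f_surjective e
    rw [H.multiplicity_apply]
    have h1 : ∀ x : f.ker, Ψ s (p (γ * x)) * conj (X (γ * x)) =
        X (γ * x) * conj (X (γ * x)) * s (f γ) := fun x => by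
      rw [hΨ s hs, map_mul, (show f x = 1 from x.2), mul_one]
      ring
    simp only [h1, ← Finset.sum_mul]
    rw [← mul_assoc, H.average_norm hθ.2, one_mul]
  refine Nat.card_congr
    { toFun := fun ψ => ⟨multiplicityChar f p X ψ.1, ?_, ?_, ?_⟩
      invFun := fun s => ⟨Ψ s.1, ?_, ?_, ?_⟩
      left_inv := fun ψ => Subtype.ext (funext fun g => ?_)
      right_inv := fun s => Subtype.ext (hmult s.1 s.2) }
  · exact (H.isIrrChar_multiplicity hθ.2 ψ.2.1 ψ.2.2.1).1
  · intro e y hy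
    obtain ⟨z, hz, rfl⟩ := H.exists_of_mem_ker y hy
    exact hl' z hz ψ e
  · obtain ⟨m, hm, hm'⟩ := ψ.2.2.2
    refine ⟨m, ?_, by rw [hm', hcard]⟩
    have h1 := (H.isIrrChar_multiplicity hθ.2 ψ.2.1 ψ.2.2.1).2 1
    rw [map_one, map_one, hm, hX1] at h1
    exact (mul_left_cancel₀ hθ.degree_ne_zero h1).symm
  · have h1 : (fun γ => Ψ s.1 (p γ)) = fun γ => X γ * s.1 (f γ) := funext (hΨ s.1 s.2)
    refine ⟨IsChar.descend H.p_surjective ?_, ?_⟩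
    · rw [h1]
      exact H.isChar.mul (s.2.1.1.comp f)
    · rw [← charInner_comp H.p_surjective, h1, H.charInner_mul hθ.2, s.2.1.2]
  · rw [← H.multiplicity_one, hmult s.1 s.2]
    exact s.2.1.degree_ne_zero
  · obtain ⟨d, hd, hd'⟩ := s.2.2.2
    refine ⟨d, ?_, by rw [hd', hcard]⟩
    rw [← map_one p, hΨ s.1 s.2, map_one, hd, hX1]
  · obtain ⟨γ, rfl⟩ := H.p_surjective g
    have h1 := H.isIrrChar_multiplicity hθ.2 ψ.2.1 ψ.2.2.1
    have h2 : ∀ γ, Ψ (multiplicityChar f p X ψ.1) (p γ) = X γ * multiplicityChar f p X ψ.1 (f γ) :=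
      hΨ _ ⟨h1.1, fun e y hy => by
        obtain ⟨z, hz, rfl⟩ := H.exists_of_mem_ker y hy
        exact hl' z hz ψ e, by
        obtain ⟨m, hm, hm'⟩ := ψ.2.2.2
        refine ⟨m, ?_, by rw [hm', hcard]⟩
        have h1 := h1.2 1
        rw [map_one, map_one, hm, hX1] at h1
        exact (mul_left_cancel₀ hθ.degree_ne_zero h1).symm⟩
    exact (h2 γ).trans (h1.2 γ).symm

theorem card_dzSet_eq_card_rdzSet [Finite Γ] [Finite E] [Finite G]
    (H : ExtendedTriple N θ f p h X) (hθ : IsIrrChar N θ) {π : Set ℕ} {m : ℕ}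
    (hm : IsPiNumber π m) (hz : ∀ z ∈ p.ker, z ^ m = 1) :
    Nat.card (dzSet π (G ⧸ N)) = Nat.card (rdzSet π G N θ) := by
  obtain ⟨ψ, hψ, hψθ⟩ := N.exists_charInner_ne_zero hθ.degree_ne_zero
  have hs₀ := H.isChar_multiplicity hψ
  have hs₀1 : multiplicityChar f p X ψ 1 ≠ 0 := by rwa [H.multiplicity_one]
  let l : E → ℂ := fun e => multiplicityChar f p X ψ e / multiplicityChar f p X ψ 1
  have hl0 : ∀ z ∈ p.ker, ∃ w : ℂ, w * conj w = 1 ∧ (∀ γ, X (γ * z) = w * X γ) ∧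
      l (f z) = conj w := fun z hz => by
    obtain ⟨w, hw, hwX⟩ := H.scalar z hz
    have h1 := H.multiplicity_mul ψ hz hwX 1
    rw [one_mul] at h1
    exact ⟨w, hw, hwX, by simp only [l]; rw [h1, mul_div_cancel_right₀ _ hs₀1]⟩
  have hl : ∀ z ∈ p.ker, ∀ γ, l (f z) * X (γ * z) = X γ := fun z hz γ => by
    obtain ⟨w, hw, hwX, hlw⟩ := hl0 z hz
    rw [hlw, hwX, ← mul_assoc, mul_comm (conj w), hw, one_mul]
  have hl' : ∀ z ∈ p.ker, ∀ (ψ : G → ℂ) (e : E),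
      multiplicityChar f p X ψ (e * f z) = l (f z) * multiplicityChar f p X ψ e := fun z hz ψ e => by
    obtain ⟨w, hw, hwX, hlw⟩ := hl0 z hz
    rw [hlw, H.multiplicity_mul ψ hz hwX]
  have hs₀l : ∀ e, ∀ y ∈ h.ker,
      multiplicityChar f p X ψ (e * y) = l y * multiplicityChar f p X ψ e := fun e y hy => by
    obtain ⟨z, hz, rfl⟩ := H.exists_of_mem_ker y hy
    exact hl' z hz ψ e
  have hh : Function.Surjective h := fun x => by
    obtain ⟨g, rfl⟩ := QuotientGroup.mk_surjective x
    obtain ⟨γ, rfl⟩ := H.p_surjective g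
    exact ⟨f γ, H.comm γ⟩
  obtain ⟨j, k, hπ⟩ := exists_piExtension (h := h) hh (fun y hy e => by
    obtain ⟨z, hz, rfl⟩ := H.exists_of_mem_ker y hy
    obtain ⟨γ, rfl⟩ := H.f_surjective e
    rw [← map_mul, H.central z hz, map_mul]) hm (fun y hy => by
    obtain ⟨z, hz', rfl⟩ := H.exists_of_mem_ker y hy
    rw [← map_pow, hz z hz', map_one]) hs₀ hs₀1 hs₀l
  rw [H.card_rdzSet hθ π hl hl']
  exact hπ.card_dzSet_eq_card_dzOver hs₀ hs₀1 hs₀l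

end ExtendedTriple

end gallagher

theorem IsTwoCocycle.exists_coboundary {Q : Type} [Group Q] [Finite Q] {a : Q → Q → ℂˣ}
    (ha : IsTwoCocycle a) :
    0 < cocycleClassOrder a ∧ IsTwoCoboundary fun x y => a x y ^ cocycleClassOrder a := by
  cases nonempty_fintype Q
  have hne : {m | 0 < m ∧ IsTwoCoboundary fun x y => a x y ^ m}.Nonempty := by
    refine ⟨Fintype.card Q, Fintype.card_pos, fun x => ∏ z, a x z, fun x y => ?_⟩
    beta_reduce
    rw [eq_mul_inv_iff_mul_eq, ← Finset.card_univ, ← Finset.prod_const, ← Finset.prod_mul_distrib,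
      mul_comm (∏ z, a x z),
      ← Fintype.prod_equiv (Equiv.mulLeft y) (fun z => a x (y * z)) (fun z => a x z)
        fun _ => rfl, ← Finset.prod_mul_distrib]
    exact Finset.prod_congr rfl fun z _ => ha x y z
  exact Nat.sInf_mem hne

namespace ProjRepOfTriple

variable {G : Type} [Group G] {N : Subgroup G} [N.Normal] {θ : N → ℂ}

theorem nat_cast_d (P : ProjRepOfTriple G N θ) : (P.d : ℂ) = θ 1 := by
  rw [← P.traceN 1, Subgroup.coe_one, P.map_one, Matrix.trace_one, Fintype.card_fin]

theorem a_one (P : ProjRepOfTriple G N θ) (hθ : θ 1 ≠ 0) : P.a 1 1 = 1 := by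
  have h1 := congrArg Matrix.trace (P.factor 1 1)
  rw [mul_one, P.map_one, mul_one, Matrix.trace_smul, Matrix.trace_one, Fintype.card_fin,
    P.nat_cast_d, smul_eq_mul, QuotientGroup.mk_one] at h1
  exact Units.ext (mul_right_cancel₀ hθ (by rw [← h1, Units.val_one, one_mul]))

/-- The group of the scalar multiples `w • X g` with `w ^ m * ν g = 1`. -/
def cover (P : ProjRepOfTriple G N θ) (m : ℕ) (ν : G ⧸ N → ℂˣ) (hν1 : ν 1 = 1)
    (hν : ∀ x y, P.a x y ^ m = ν x * ν y * (ν (x * y))⁻¹) :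
    Subgroup (G × (Matrix (Fin P.d) (Fin P.d) ℂ)ˣ) where
  carrier := {γ | ∃ w : ℂˣ, w ^ m * ν γ.1 = 1 ∧ γ.2.val = (w : ℂ) • P.X γ.1}
  one_mem' := ⟨1, by simp [hν1], by simp [P.map_one]⟩
  mul_mem' := by
    rintro ⟨g, M⟩ ⟨g', M'⟩ ⟨w, hw, hM⟩ ⟨w', hw', hM'⟩
    refine ⟨w * w' * P.a g g', ?_, ?_⟩
    · rw [mul_pow, mul_pow, hν, Prod.fst_mul, QuotientGroup.mk_mul]
      simp only at hw hw' ⊢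
      calc _ = (w ^ m * ν g) * (w' ^ m * ν g') * ((ν (g * g'))⁻¹ * ν (g * g')) := by
            simp only [mul_assoc, mul_left_comm, mul_comm]
        _ = 1 := by rw [hw, hw', inv_mul_cancel, one_mul, one_mul]
    · simp only at hM hM'
      simp only [Prod.snd_mul, Units.val_mul, hM, hM', Prod.fst_mul, smul_mul_smul_comm, P.factor,
        smul_smul]
  inv_mem' := by
    rintro ⟨g, M⟩ ⟨w, hw, hM⟩
    simp only at hw hM
    refine ⟨(w * P.a g g⁻¹)⁻¹, ?_, ?_⟩
    · have h1 := hν g (g : G ⧸ N)⁻¹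
      rw [mul_inv_cancel, hν1, inv_one, mul_one] at h1
      rw [inv_pow, mul_pow, h1, Prod.fst_inv, QuotientGroup.mk_inv, ← mul_assoc, hw, one_mul,
        inv_mul_cancel]
    · rw [Prod.snd_inv]
      refine Units.inv_eq_of_mul_eq_one_right ?_
      rw [hM, Prod.fst_inv, smul_mul_smul_comm, P.factor, mul_inv_cancel, P.map_one, smul_smul,
        QuotientGroup.mk_inv, mul_right_comm, ← Units.val_mul, Units.mul_inv, one_smul]

section cover

variable (P : ProjRepOfTriple G N θ) {m : ℕ} {ν : G ⧸ N → ℂˣ} (hν1 : ν 1 = 1)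
  (hν : ∀ x y, P.a x y ^ m = ν x * ν y * (ν (x * y))⁻¹)

theorem exists_mem_cover {g : G} {w : ℂˣ} (hw : w ^ m * ν g = 1) :
    ∃ γ ∈ P.cover m ν hν1 hν, γ.1 = g ∧ γ.2.val = (w : ℂ) • P.X g := by
  obtain ⟨u, hu⟩ := P.unit g
  refine ⟨⟨g, Units.map (algebraMap ℂ (Matrix _ _ ℂ)).toMonoidHom w * u⟩, ⟨w, hw, ?_⟩, rfl, ?_⟩ <;>
  simp [hu, Algebra.algebraMap_eq_smul_one]

theorem finite_cover [Finite G] (hm : 0 < m) : Finite (P.cover m ν hν1 hν) := by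
  have hfin : ∀ c : ℂ, Finite {w : ℂ // w ^ m = c} := fun c =>
    ((Polynomial.nthRootsFinset m c).finite_toSet.subset
      fun w hw => (Polynomial.mem_nthRootsFinset hm c).2 hw).to_subtype
  let F : P.cover m ν hν1 hν → Σ g : G, {w : ℂ // w ^ m = ((ν g)⁻¹ : ℂˣ)} := fun γ =>
    ⟨γ.1.1, (γ.2.choose : ℂ), by
      rw [← Units.val_pow_eq_pow_val, eq_inv_of_mul_eq_one_left γ.2.choose_spec.1]⟩
  refine Finite.of_injective F fun γ γ' hγ => ?_
  have hF : ∀ γ, γ.1.2.val = (F γ).2.1 • P.X (F γ).1 := fun γ => γ.2.choose_spec.2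
  exact Subtype.ext (Prod.ext (congrArg Sigma.fst hγ) (Units.ext (by rw [hF, hF, hγ])))

/-- The copy of `N` in the cover. -/
def coverKer : Subgroup (P.cover m ν hν1 hν) where
  carrier := {γ | γ.1.1 ∈ N ∧ γ.1.2.val = P.X γ.1.1}
  one_mem' := ⟨one_mem _, P.map_one.symm⟩
  mul_mem' := by
    rintro γ γ' ⟨h1, h2⟩ ⟨h3, h4⟩
    refine ⟨mul_mem h1 h3, ?_⟩
    change γ.1.2.val * γ'.1.2.val = P.X (γ.1.1 * γ'.1.1)
    rw [h2, h4, ← P.mulN_left ⟨_, h1⟩]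
  inv_mem' := by
    rintro γ ⟨h1, h2⟩
    refine ⟨inv_mem h1, ?_⟩
    refine Units.inv_eq_of_mul_eq_one_right ?_
    rw [h2]
    change P.X γ.1.1 * P.X (γ.1.1)⁻¹ = 1
    rw [← P.mulN_left ⟨_, h1⟩, mul_inv_cancel, P.map_one]

instance normal_coverKer : (P.coverKer hν1 hν).Normal where
  conj_mem := by
    rintro γ ⟨h1, h2⟩ δ
    refine ⟨(inferInstance : N.Normal).conj_mem _ h1 _, ?_⟩
    obtain ⟨w, hw, hM⟩ := δ.2
    change δ.1.2.val * γ.1.2.val * (δ.1.2⁻¹).val =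
      P.X (δ.1.1 * γ.1.1 * δ.1.1⁻¹)
    rw [Units.mul_inv_eq_iff_eq_mul, h2, hM, Matrix.smul_mul, Matrix.mul_smul,
      ← P.mulN_right ⟨_, h1⟩,
      ← P.mulN_left ⟨_, (inferInstance : N.Normal).conj_mem _ h1 _⟩, inv_mul_cancel_right]

/-- The projection of the cover to `G`. -/
def coverFst : P.cover m ν hν1 hν →* G := (MonoidHom.fst _ _).comp (Subgroup.subtype _)

/-- The projection of the quotient of the cover by the copy of `N` to `G ⧸ N`. -/
def coverQuotient : P.cover m ν hν1 hν ⧸ P.coverKer hν1 hν →* G ⧸ N :=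
  QuotientGroup.map _ _ (P.coverFst hν1 hν) fun _ h => h.1

/-- An element of the kernel of the projection is a scalar matrix. -/
theorem exists_of_mem_ker_coverFst {z : P.cover m ν hν1 hν}
    (hz : z ∈ (P.coverFst hν1 hν).ker) :
    ∃ w : ℂˣ, w ^ m = 1 ∧ z.1.2.val = (w : ℂ) • 1 := by
  obtain ⟨w, hw, hM⟩ := z.2
  have h1 : z.1.1 = 1 := hz
  rw [h1, P.map_one] at hM
  rw [h1, QuotientGroup.mk_one, hν1, mul_one] at hw
  exact ⟨w, hw, hM⟩

theorem cover_ext {γ γ' : P.cover m ν hν1 hν} (h1 : γ.1.1 = γ'.1.1)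
    (h2 : γ.1.2.val = γ'.1.2.val) : γ = γ' :=
  Subtype.ext (Prod.ext h1 (Units.ext h2))

theorem pow_eq_one_of_mem_ker_coverFst {z : P.cover m ν hν1 hν}
    (hz : z ∈ (P.coverFst hν1 hν).ker) : z ^ m = 1 := by
  obtain ⟨w, hw, hM⟩ := P.exists_of_mem_ker_coverFst hν1 hν hz
  refine P.cover_ext hν1 hν ?_ ?_
  · change z.1.1 ^ m = 1
    rw [show z.1.1 = 1 from hz, one_pow]
  · change (z.1.2 ^ m).val = 1
    rw [Units.val_pow_eq_pow_val, hM, smul_pow, one_pow, ← Units.val_pow_eq_pow_val, hw,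
      Units.val_one, one_smul]

theorem extendedTriple_cover (hm : 0 < m) :
    ExtendedTriple N θ (QuotientGroup.mk' (P.coverKer hν1 hν)) (P.coverFst hν1 hν)
      (P.coverQuotient hν1 hν) fun γ => γ.1.2.val.trace where
  f_surjective := QuotientGroup.mk'_surjective _
  p_surjective g := by
    obtain ⟨w, hw⟩ := IsAlgClosed.exists_pow_nat_eq (((ν g)⁻¹ : ℂˣ) : ℂ) hm
    have hw0 : w ≠ 0 := by
      rintro rfl
      rw [zero_pow hm.ne'] at hw
      exact Units.ne_zero _ hw.symm
    obtain ⟨γ, hγ, h1, -⟩ := P.exists_mem_cover hν1 hν (g := g) (w := Units.mk0 w hw0)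
      (mul_eq_one_iff_eq_inv.2 (Units.ext hw))
    exact ⟨⟨γ, hγ⟩, h1⟩
  comm _ := rfl
  exists_of_mem_ker e he := by
    obtain ⟨γ, rfl⟩ := QuotientGroup.mk_surjective e
    have hN : γ.1.1 ∈ N := (QuotientGroup.eq_one_iff _).1 he
    obtain ⟨w, hw, hM⟩ := γ.2
    rw [(QuotientGroup.eq_one_iff _).2 hN, hν1, mul_one] at hw
    obtain ⟨z, hz, hz1, hz2⟩ := P.exists_mem_cover hν1 hν (g := 1) (w := w)
      (by rw [hw, QuotientGroup.mk_one, hν1, one_mul])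
    refine ⟨⟨z, hz⟩, hz1, ?_⟩
    refine QuotientGroup.eq.2 ⟨?_, ?_⟩
    · change z.1⁻¹ * γ.1.1 ∈ N
      rwa [hz1, inv_one, one_mul]
    · change (z.2⁻¹).val * γ.1.2.val = P.X (z.1⁻¹ * γ.1.1)
      rw [Units.inv_mul_eq_iff_eq_mul, hM, hz2, hz1, inv_one, one_mul, P.map_one,
        Matrix.smul_mul, one_mul]
  exists_of_mem n hn := by
    obtain ⟨γ, hγ, h1, h2⟩ := P.exists_mem_cover hν1 hν (g := n) (w := 1)
      (by rw [(QuotientGroup.eq_one_iff _).2 hn, hν1, one_pow, one_mul])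
    refine ⟨⟨γ, hγ⟩, ?_, h1⟩
    rw [QuotientGroup.ker_mk']
    subst h1
    exact ⟨hn, by rw [h2, Units.val_one, one_smul]⟩
  eq_one x hx hx1 := by
    rw [QuotientGroup.ker_mk'] at hx
    refine P.cover_ext hν1 hν hx1 ?_
    rw [hx.2, show x.1.1 = 1 from hx1, P.map_one]
    rfl
  central z hz γ := by
    obtain ⟨w, hw, hM⟩ := P.exists_of_mem_ker_coverFst hν1 hν hz
    refine P.cover_ext hν1 hν ?_ ?_
    · change z.1.1 * γ.1.1 = γ.1.1 * z.1.1
      rw [show z.1.1 = 1 from hz, one_mul, mul_one]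
    · change z.1.2.val * γ.1.2.val = γ.1.2.val * z.1.2.val
      rw [hM, Matrix.smul_mul, Matrix.mul_smul, one_mul, mul_one]
  isChar := IsChar.of_matrix (n := Fin P.d) ((Units.coeHom (Matrix (Fin P.d) (Fin P.d) ℂ)).comp
    ((MonoidHom.snd G _).comp (Subgroup.subtype (P.cover m ν hν1 hν)))) fun _ => rfl
  scalar z hz := by
    obtain ⟨w, hw, hM⟩ := P.exists_of_mem_ker_coverFst hν1 hν hz
    refine ⟨w, ?_, fun γ => ?_⟩
    · have h1 : ‖(w : ℂ)‖ = 1 := Complex.norm_eq_one_of_pow_eq_one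
        (by rw [← Units.val_pow_eq_pow_val, hw, Units.val_one]) hm.ne'
      rw [Complex.mul_conj', h1]
      simp
    · change (γ.1.2.val * z.1.2.val).trace = _
      rw [hM, Matrix.mul_smul, mul_one, Matrix.trace_smul, smul_eq_mul]
  extends_theta x hx hxN := by
    rw [QuotientGroup.ker_mk'] at hx
    rw [hx.2]
    exact P.traceN ⟨_, hxN⟩

end cover

end ProjRepOfTriple

theorem card_dz_eq_card_rdz
    {G : Type} [Group G] [Finite G] (π : Set ℕ) (N : Subgroup G) [N.Normal]
    (θ : ↥N → ℂ) (hθ : IsIrrChar ↥N θ) (hinv : IsGInvariant N θ)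
    (P : ProjRepOfTriple G N θ) (hord : IsPiNumber π (cocycleClassOrder P.a)) :
    Nat.card (dzSet π (G ⧸ N)) = Nat.card (rdzSet π G N θ) := by
  obtain ⟨hm, ν, hν⟩ := P.cocycle.exists_coboundary
  have hν1 : ν 1 = 1 := by
    have h1 := hν 1 1
    beta_reduce at h1
    rw [P.a_one hθ.degree_ne_zero, one_pow, mul_one, mul_inv_cancel_right] at h1
    exact h1.symm
  have := P.finite_cover hν1 hν hm
  exact (P.extendedTriple_cover hν1 hν hm).card_dzSet_eq_card_rdzSet hθ hord
    fun z hz => P.pow_eq_one_of_mem_ker_coverFst hν1 hν hz
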